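/- arXiv:2408.10208 — 8 statements merged into one kernel-verified Lean document; each statement's English description precedes it below -/
import Mathlib

section
/- Let a > 0 and b, c, ζ ∈ ℝ, and set q = a + i·b ∈ ℂ. Define G : ℝ² × ℝ → ℂ by G(x₁,x₂,t) = (1 + 4·i·q·t)^(−1/2) · exp(−q·(x₁ − c·t)² / (1 + 4·i·q·t)) · exp(i·(c/2)·x₁ − i·(c²/4)·t) · exp(i·ζ·x₂ − i·ζ²·t), where z^(−1/2) denotes the principal branch of the complex power. Then G satisfies the two-dimensional free Schrödinger equation i·∂ₜG + ∂²_{x₁}G + ∂²_{x₂}G = 0 at every point of ℝ² × ℝ. -/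
theorem deriv_deriv_of_hasDerivAt_mul {f p : ℝ → ℂ} {p' : ℂ} {x : ℝ}
    (hf : ∀ y, HasDerivAt f (f y * p y) y) (hp : HasDerivAt p p' x) :
    deriv (deriv f) x = f x * (p x ^ 2 + p') := by
  have h : deriv f = fun y => f y * p y := funext fun y => (hf y).deriv
  rw [h, ← Pi.mul_def, ((hf x).mul hp).deriv]
  ring

theorem one_add_four_I_mul_mem_slitPlane {q : ℂ} (hq : q.re ≠ 0) (t : ℝ) :
    1 + 4 * Complex.I * q * (t : ℂ) ∈ Complex.slitPlane := by
  rw [Complex.mem_slitPlane_iff]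
  by_cases ht : t = 0
  · simp [ht]
  · right
    simp [ht, hq]


/-- The Fourier-Chirped-Gaussian profile
`G(x₁,x₂,t) = (1+4iqt)^(-1/2) exp(-q(x₁-ct)²/(1+4iqt)) exp(i(c/2)x₁ - i(c²/4)t)
exp(iζx₂ - iζ²t)` with `q = a + ib`, `a > 0`, solves the two-dimensional free
Schrödinger equation `i ∂ₜG + ∂²_{x₁}G + ∂²_{x₂}G = 0`. -/
theorem stmt3 (a b c ζ : ℝ) (ha : 0 < a) (q : ℂ) (hq : q = (a : ℂ) + Complex.I * (b : ℂ))
    (G : ℝ → ℝ → ℝ → ℂ)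
    (hG : ∀ x₁ x₂ t : ℝ, G x₁ x₂ t =
      (1 + 4 * Complex.I * q * (t : ℂ)) ^ (-(1/2) : ℂ) *
        Complex.exp (-q * ((x₁ : ℂ) - (c : ℂ) * (t : ℂ)) ^ 2 /
          (1 + 4 * Complex.I * q * (t : ℂ))) *
        Complex.exp (Complex.I * ((c : ℂ) / 2) * (x₁ : ℂ) -
          Complex.I * ((c : ℂ) ^ 2 / 4) * (t : ℂ)) *
        Complex.exp (Complex.I * (ζ : ℂ) * (x₂ : ℂ) -
          Complex.I * (ζ : ℂ) ^ 2 * (t : ℂ))) :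
    ∀ x₁ x₂ t : ℝ,
      Complex.I * deriv (fun τ : ℝ => G x₁ x₂ τ) t +
        deriv (deriv (fun ξ : ℝ => G ξ x₂ t)) x₁ +
        deriv (deriv (fun υ : ℝ => G x₁ υ t)) x₂ = 0 := by
  intro x₁ x₂ t
  have hslit : 1 + 4 * Complex.I * q * (t : ℂ) ∈ Complex.slitPlane :=
    one_add_four_I_mul_mem_slitPlane (by simp [hq, ha.ne']) t
  have hw : 1 + 4 * Complex.I * q * (t : ℂ) ≠ 0 := Complex.slitPlane_ne_zero hslit
  have hid (y : ℝ) : HasDerivAt (fun s : ℝ => (s : ℂ)) 1 y := Complex.ofRealCLM.hasDerivAt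
  have hx₁ (y : ℝ) : HasDerivAt (fun ξ : ℝ => G ξ x₂ t)
      (G y x₂ t * (-q * (2 * ((y : ℂ) - c * t)) / (1 + 4 * Complex.I * q * t) +
        Complex.I * (c / 2))) y := by
    simp only [hG]
    have h₁ := (((((hid y).sub_const ((c : ℂ) * t)).pow 2).const_mul (-q)).div_const
      (1 + 4 * Complex.I * q * (t : ℂ))).cexp
    have h₂ := (((hid y).const_mul (Complex.I * ((c : ℂ) / 2))).sub_const
      (Complex.I * ((c : ℂ) ^ 2 / 4) * t)).cexp
    refine (((h₁.const_mul _).mul h₂).mul_const _).congr_deriv ?_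
    simp only [Pi.pow_apply]
    push_cast
    ring
  have hp₁ : HasDerivAt (fun y : ℝ => -q * (2 * ((y : ℂ) - c * t)) /
      (1 + 4 * Complex.I * q * t) + Complex.I * (c / 2))
      (-q * 2 / (1 + 4 * Complex.I * q * t)) x₁ := by
    refine (((((hid x₁).sub_const ((c : ℂ) * t)).const_mul 2).const_mul (-q)).div_const
      (1 + 4 * Complex.I * q * (t : ℂ))).add_const _ |>.congr_deriv ?_
    ring
  have hx₂ (y : ℝ) : HasDerivAt (fun υ : ℝ => G x₁ υ t) (G x₁ y t * (Complex.I * ζ)) y := by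
    simp only [hG]
    have h := (((hid y).const_mul (Complex.I * (ζ : ℂ))).sub_const
      (Complex.I * (ζ : ℂ) ^ 2 * t)).cexp
    refine (h.const_mul _).congr_deriv ?_
    ring
  have hlin : HasDerivAt (fun s : ℝ => 1 + 4 * Complex.I * q * (s : ℂ))
      (4 * Complex.I * q) t := by
    simpa using ((hid t).const_mul (4 * Complex.I * q)).const_add 1
  have hpow : HasDerivAt (fun s : ℝ => (1 + 4 * Complex.I * q * (s : ℂ)) ^ (-(1/2) : ℂ))
      ((1 + 4 * Complex.I * q * (t : ℂ)) ^ (-(1/2) : ℂ) *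
        (-2 * Complex.I * q / (1 + 4 * Complex.I * q * t))) t := by
    have h := (((hasDerivAt_id _).cpow_const (c := (-(1/2) : ℂ)) hslit).comp t hlin)
    refine h.congr_deriv ?_
    simp only [id_eq]
    rw [Complex.cpow_sub _ _ hw, Complex.cpow_one]
    ring
  have ht : HasDerivAt (fun τ : ℝ => G x₁ x₂ τ)
      (G x₁ x₂ t * (-2 * Complex.I * q / (1 + 4 * Complex.I * q * t) +
        (2 * q * c * ((x₁ : ℂ) - c * t) / (1 + 4 * Complex.I * q * t) +
          4 * Complex.I * q ^ 2 * ((x₁ : ℂ) - c * t) ^ 2 / (1 + 4 * Complex.I * q * t) ^ 2) -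
        Complex.I * (c ^ 2 / 4) - Complex.I * ζ ^ 2)) t := by
    simp only [hG]
    have h₁ := ((((((hid t).const_mul (c : ℂ)).const_sub (x₁ : ℂ)).pow 2).const_mul (-q)).div
      hlin hw).cexp
    have h₂ := (((hid t).const_mul (Complex.I * ((c : ℂ) ^ 2 / 4))).const_sub
      (Complex.I * ((c : ℂ) / 2) * x₁)).cexp
    have h₃ := (((hid t).const_mul (Complex.I * (ζ : ℂ) ^ 2)).const_sub
      (Complex.I * (ζ : ℂ) * x₂)).cexp
    refine (((hpow.mul h₁).mul h₂).mul h₃).congr_deriv ?_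
    simp only [Pi.pow_apply, Pi.mul_apply, Pi.div_apply]
    push_cast
    generalize (1 + 4 * Complex.I * q * (t : ℂ)) ^ (-(1/2) : ℂ) = A
    generalize 1 + 4 * Complex.I * q * (t : ℂ) = w at hw ⊢
    field_simp
    ring
  rw [ht.deriv, deriv_deriv_of_hasDerivAt_mul hx₁ hp₁,
    deriv_deriv_of_hasDerivAt_mul hx₂ (hasDerivAt_const _ _)]
  generalize 1 + 4 * Complex.I * q * (t : ℂ) = w at hw ⊢
  field_simp
  ring_nf
  simp only [Complex.I_sq]
  ring
end

section
/- Let a > 0, m ∈ ℕ, and γ ∈ ℂ with γ ≠ 0. Let H : ℕ → Polynomial ℝ be the physicists' Hermite polynomials, i.e., H 0 = 1, H 1 = 2X, and H (n+1) = 2X·(H n) − 2n·(H (n−1)) for n ≥ 1. Define, for (x,t) ∈ ℝ × ℝ: w(t) = √(1 + (4·a·t)²), θ(t) = arctan(4·a·t), μ(t) = a/(1 + 4·i·a·t), and 𝒢ₘ(x,t) = γ⁻¹ · H m (√(2a)·x / w(t)) · (1 + 4·i·a·t)^(−1/2) · exp(−μ(t)·x² − i·m·θ(t)), where z^(−1/2)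 denotes the principal branch of the complex power (note Re(1 + 4·i·a·t) = 1 > 0). Then 𝒢ₘ satisfies the one-dimensional free Schrödinger equation i·∂ₜ𝒢ₘ(x,t) + ∂ₓ²𝒢ₘ(x,t) = 0 for all (x,t) ∈ ℝ × ℝ. -/
open Polynomial in
/-- The Hermite recurrence gives the derivative rule `H' (n+1) = 2 (n+1) H n`. -/
theorem hermite_derivative_succ (H : ℕ → Polynomial ℝ)
    (hH0 : H 0 = 1) (hH1 : H 1 = 2 * X)
    (hHrec : ∀ n : ℕ, 1 ≤ n → H (n + 1) = 2 * X * H n - C (2 * (n : ℝ)) * H (n - 1))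
    (n : ℕ) : derivative (H (n + 1)) = 2 * ((n : ℝ[X]) + 1) * H n := by
  induction n using Nat.strong_induction_on with
  | _ n ih =>
    match n with
    | 0 => simp [hH0, hH1]
    | 1 =>
      have h := hHrec 1 le_rfl
      norm_num [hH0, hH1] at h
      norm_num [h, hH1]
      ring
    | k + 2 =>
      have h := hHrec (k + 2) (by omega)
      have h' := hHrec (k + 1) (by omega)
      have ih1 := ih (k + 1) (by omega)
      have ih0 := ih k (by omega)
      simp only [Nat.add_sub_cancel, show k + 2 - 1 = k + 1 by omega, map_mul, map_natCast,
        map_ofNat] at h h'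
      rw [h]
      simp only [derivative_sub, derivative_mul, derivative_X, derivative_natCast,
        derivative_ofNat, ih1, ih0]
      rw [show k + 1 + 1 = k + 2 from rfl] at h'
      rw [h']
      push_cast
      ring

open Polynomial in
/-- The Hermite differential equation `H'' - 2 y H' + 2 m H = 0`. -/
theorem hermite_ode (H : ℕ → Polynomial ℝ)
    (hH0 : H 0 = 1) (hH1 : H 1 = 2 * X)
    (hHrec : ∀ n : ℕ, 1 ≤ n → H (n + 1) = 2 * X * H n - C (2 * (n : ℝ)) * H (n - 1))
    (m : ℕ) (y : ℝ) :
    (derivative (derivative (H m))).eval y - 2 * y * (derivative (H m)).eval y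
      + 2 * m * (H m).eval y = 0 := by
  have hd := hermite_derivative_succ H hH0 hH1 hHrec
  match m with
  | 0 => simp [hH0]
  | 1 =>
    norm_num [hH1]
    ring
  | k + 2 =>
    have h := hHrec (k + 1) (by omega)
    have h1 := hd (k + 1)
    have h0 := hd k
    simp only [Nat.add_sub_cancel, map_mul, map_natCast, map_ofNat] at h
    rw [show k + 1 + 1 = k + 2 from rfl] at h h1
    rw [h1]
    simp only [derivative_mul, derivative_add, derivative_natCast, derivative_ofNat,
      derivative_one, h0, h]
    push_cast
    simp only [eval_mul, eval_add, eval_sub, eval_X, eval_natCast, eval_ofNat, eval_one,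
      eval_zero]
    ring

/-- The real variable derivative of a polynomial times a Gaussian. -/
theorem hasDerivAt_eval_mul_gaussian (P : Polynomial ℝ) (k : ℝ) (K μ c : ℂ) (x : ℝ) :
    HasDerivAt (fun ξ : ℝ => K * ((P.eval (k * ξ) : ℝ) : ℂ) *
        Complex.exp (-μ * (ξ : ℂ) ^ 2 - c))
      (K * ((k * P.derivative.eval (k * x) : ℝ) - 2 * μ * x * (P.eval (k * x) : ℝ)) *
        Complex.exp (-μ * (x : ℂ) ^ 2 - c)) x := by
  have hP : HasDerivAt (fun ξ : ℝ => P.eval (k * ξ)) (k * P.derivative.eval (k * x)) x := by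
    have := (P.hasDerivAt (k * x)).comp x ((hasDerivAt_id x).const_mul k)
    exact this.congr_deriv (by ring)
  have hx : HasDerivAt (fun ξ : ℝ => (ξ : ℂ)) 1 x := (hasDerivAt_id x).ofReal_comp
  have hE := (((hx.pow 2).const_mul (-μ)).sub_const c).cexp
  refine ((hP.ofReal_comp.const_mul K).mul hE).congr_deriv ?_
  simp only [Pi.pow_apply]
  push_cast
  ring

/-- The second derivative of a polynomial times a Gaussian. -/
theorem deriv_deriv_eval_mul_gaussian (P : Polynomial ℝ) (k : ℝ) (K μ c : ℂ) (x : ℝ) :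
    deriv (deriv (fun ξ : ℝ => K * ((P.eval (k * ξ) : ℝ) : ℂ) *
        Complex.exp (-μ * (ξ : ℂ) ^ 2 - c))) x =
      K * ((k ^ 2 * P.derivative.derivative.eval (k * x) : ℝ)
          - 4 * μ * x * (k * P.derivative.eval (k * x) : ℝ)
          + (4 * μ ^ 2 * x ^ 2 - 2 * μ) * (P.eval (k * x) : ℝ)) *
        Complex.exp (-μ * (x : ℂ) ^ 2 - c) := by
  rw [funext fun ξ => (hasDerivAt_eval_mul_gaussian P k K μ c ξ).deriv]
  have hx : HasDerivAt (fun ξ : ℝ => (ξ : ℂ)) 1 x := (hasDerivAt_id x).ofReal_comp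
  have h1 := hasDerivAt_eval_mul_gaussian P.derivative k (K * k) μ c x
  have h2 := (hx.const_mul (2 * μ)).mul (hasDerivAt_eval_mul_gaussian P k K μ c x)
  have h := h1.sub h2
  refine Eq.trans (congrArg (fun f => deriv f x) ?_) (h.deriv.trans ?_)
  · funext ξ
    simp only [Pi.sub_apply, Pi.mul_apply]
    push_cast
    ring
  · push_cast
    ring


/-- The Hermite-Gaussian profile
`𝒢ₘ(x,t) = γ⁻¹ Hₘ(√(2a) x / w(t)) (1+4iat)^(-1/2) exp(-μ(t)x² - i m θ(t))`,
with `w(t) = √(1+(4at)²)`, `θ(t) = arctan(4at)`, `μ(t) = a/(1+4iat)`, solves the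
one-dimensional free Schrödinger equation `i ∂ₜ𝒢ₘ + ∂ₓ²𝒢ₘ = 0`. -/
theorem stmt5 (a : ℝ) (ha : 0 < a) (m : ℕ) (γ : ℂ) (hγ : γ ≠ 0)
    (H : ℕ → Polynomial ℝ)
    (hH0 : H 0 = 1) (hH1 : H 1 = 2 * Polynomial.X)
    (hHrec : ∀ n : ℕ, 1 ≤ n →
      H (n + 1) = 2 * Polynomial.X * H n - Polynomial.C (2 * (n : ℝ)) * H (n - 1))
    (G : ℝ → ℝ → ℂ)
    (hG : ∀ x t : ℝ, G x t = γ⁻¹ *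
      (((H m).eval (Real.sqrt (2 * a) * x / Real.sqrt (1 + (4 * a * t) ^ 2)) : ℝ) : ℂ) *
      (1 + 4 * Complex.I * (a : ℂ) * (t : ℂ)) ^ (-(1/2) : ℂ) *
      Complex.exp (-((a : ℂ) / (1 + 4 * Complex.I * (a : ℂ) * (t : ℂ))) * (x : ℂ) ^ 2 -
        Complex.I * (m : ℂ) * ((Real.arctan (4 * a * t) : ℝ) : ℂ))) :
    ∀ x t : ℝ,
      Complex.I * deriv (fun τ : ℝ => G x τ) t +
        deriv (deriv (fun ξ : ℝ => G ξ t)) x = 0 := by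
  intro x t
  set s : ℂ := 1 + 4 * Complex.I * (a : ℂ) * (t : ℂ) with hs
  set w : ℝ := Real.sqrt (1 + (4 * a * t) ^ 2) with hw
  have hpos : 0 < 1 + (4 * a * t) ^ 2 := by positivity
  have hw0 : w ≠ 0 := (Real.sqrt_pos.2 hpos).ne'
  have hw2 : w ^ 2 = 1 + (4 * a * t) ^ 2 := Real.sq_sqrt hpos.le
  have hre : s.re = 1 := by simp [hs]
  have hslit : s ∈ Complex.slitPlane := Or.inl (by rw [hre]; exact one_pos)
  have hs0 : s ≠ 0 := Complex.slitPlane_ne_zero hslit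
  set k : ℝ := Real.sqrt (2 * a) / w with hk
  have hk2 : k ^ 2 = 2 * a / w ^ 2 := by
    rw [hk, div_pow, Real.sq_sqrt (by positivity)]
  set θ : ℝ := Real.arctan (4 * a * t) with hθ
  set S : ℂ := s ^ (-(1 / 2) : ℂ) with hS
  have hxx : (fun ξ : ℝ => G ξ t) = fun ξ : ℝ => (γ⁻¹ * S) *
      (((H m).eval (k * ξ) : ℝ) : ℂ) *
        Complex.exp (-((a : ℂ) / s) * (ξ : ℂ) ^ 2 - Complex.I * m * θ) := by
    funext ξ
    rw [hG, show Real.sqrt (2 * a) * ξ / w = k * ξ by rw [hk]; ring]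
    ring
  rw [hxx, deriv_deriv_eval_mul_gaussian]
  have hlin : HasDerivAt (fun τ : ℝ => 4 * a * τ) (4 * a) t := by
    simpa using (hasDerivAt_id t).const_mul (4 * a)
  have hwt : HasDerivAt (fun τ : ℝ => Real.sqrt (1 + (4 * a * τ) ^ 2)) (16 * a ^ 2 * t / w) t := by
    refine (((hlin.pow 2).const_add 1).sqrt hpos.ne').congr_deriv ?_
    simp only [Pi.pow_apply, ← hw]
    field_simp
    ring
  have hy : HasDerivAt (fun τ : ℝ => Real.sqrt (2 * a) * x / Real.sqrt (1 + (4 * a * τ) ^ 2))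
      (-(k * x) * (16 * a ^ 2 * t) / w ^ 2) t := by
    refine ((hasDerivAt_const t (Real.sqrt (2 * a) * x)).div hwt hw0).congr_deriv ?_
    simp only [← hw, hk]
    field_simp
    ring
  have hP := (((H m).hasDerivAt _).comp t hy).ofReal_comp
  have hst : HasDerivAt (fun τ : ℝ => 1 + 4 * Complex.I * (a : ℂ) * (τ : ℂ))
      (4 * Complex.I * a) t := by
    simpa using ((hasDerivAt_id t).ofReal_comp.const_mul (4 * Complex.I * (a : ℂ))).const_add 1
  have hSt : HasDerivAt (fun τ : ℝ => (1 + 4 * Complex.I * (a : ℂ) * (τ : ℂ)) ^ (-(1 / 2) : ℂ))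
      (-(2 * Complex.I * a) / s * S) t := by
    refine (HasDerivAt.comp t ((hasDerivAt_id s).cpow_const (c := (-(1 / 2) : ℂ)) hslit)
      hst).congr_deriv ?_
    simp only [id, Complex.cpow_sub _ _ hs0, Complex.cpow_one, ← hS]
    field_simp
    ring
  have hθt := hlin.arctan.ofReal_comp
  have hE := ((((hasDerivAt_const t (a : ℂ)).div hst hs0).neg.mul_const ((x : ℂ) ^ 2)).sub
    (hθt.const_mul (Complex.I * (m : ℂ)))).cexp
  have hGt := (((hP.const_mul γ⁻¹).mul hSt).mul hE)
  have hfun := hGt.congr_of_eventuallyEq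
    (Filter.Eventually.of_forall fun τ => hG x τ)
  rw [hfun.deriv]
  have hyk : Real.sqrt (2 * a) * x / w = k * x := by rw [hk]; ring
  have hode : (((H m).derivative.derivative.eval (k * x) - 2 * (k * x) * (H m).derivative.eval (k * x)
      + 2 * m * (H m).eval (k * x) : ℝ) : ℂ) = 0 := by
    rw [hermite_ode H hH0 hH1 hHrec m (k * x), Complex.ofReal_zero]
  have hwc : (w : ℂ) ^ 2 = s * (1 - 4 * Complex.I * a * t) := by
    rw [← Complex.ofReal_pow, hw2, hs]
    push_cast
    linear_combination (16 * (a : ℂ) ^ 2 * t ^ 2) * Complex.I_sq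
  have hv : s⁻¹ = (1 - 4 * Complex.I * a * t) * ((w : ℂ) ^ 2)⁻¹ := by
    have hw0c : (w : ℂ) ≠ 0 := Complex.ofReal_ne_zero.2 hw0
    field_simp
    exact hwc
  simp only [Function.comp_apply, Pi.mul_apply, Pi.sub_apply, Pi.neg_apply, Pi.div_apply,
    ← hw, ← hs, ← hS, ← hθ, hyk, hk2]
  rw [← hw2]
  set E := Complex.exp (-((a : ℂ) / s) * (x : ℂ) ^ 2 - Complex.I * m * θ)
  clear_value E S s
  push_cast at hode ⊢
  simp only [div_eq_mul_inv] at hv ⊢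
  linear_combination (γ⁻¹ * S * E) * (2 * a * ((w : ℂ)⁻¹) ^ 2 * hode
    - 4 * a * k * x * ((H m).derivative.eval (k * x) : ℝ) * hv
    + ((H m).eval (k * x) : ℝ) * (4 * a ^ 2 * s⁻¹ ^ 2 * x ^ 2 - 2 * a * s⁻¹
      - 4 * a * m * (w : ℂ)⁻¹ ^ 2) * Complex.I_sq)
end

section
/- Let M ∈ ℕ. For k = 1, …, M set θₖ = k·π/(2M+1) and ηₖ = tan θₖ, and define b₀ = 2M+1 and bₖ = 2·ηₖ²·(1+ηₖ²)/(2M+1). Define the rational function R_M(x) = b₀ − Σ_{k=1}^{M} bₖ/(x + ηₖ²). Then for every real x > 0, writing w = √x, the denominator (1+w)^{2M+1} − (1−w)^{2M+1} is nonzero and R_M(x) = w·((1+w)^{2M+1} + (1−w)^{2M+1}) / ((1+w)^{2M+1} − (1−w)^{2M+1}). -/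
open Finset Filter Topology

/-- Summing `(a + ζ ^ k b) / (a - ζ ^ k b)` over all `n`-th roots of unity `ζ ^ k`. -/
theorem IsPrimitiveRoot.sum_add_div_sub {K : Type*} [Field K] {ζ : K} {n : ℕ}
    (hζ : IsPrimitiveRoot ζ n) {a b : K} (hab : a ^ n ≠ b ^ n) :
    ∑ k ∈ range n, (a + ζ ^ k * b) / (a - ζ ^ k * b) =
      n * (a ^ n + b ^ n) / (a ^ n - b ^ n) := by
  have hd : a ^ n - b ^ n ≠ 0 := sub_ne_zero.mpr hab
  have hterm (k : ℕ) : (a + ζ ^ k * b) / (a - ζ ^ k * b) =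
      2 * a * (∑ j ∈ range n, (ζ ^ j) ^ k * (b ^ j * a ^ (n - 1 - j))) / (a ^ n - b ^ n) - 1 := by
    have hpow : (ζ ^ k * b) ^ n = b ^ n := by
      rw [mul_pow, ← pow_mul, mul_comm k, pow_mul, hζ.pow_eq_one, one_pow, one_mul]
    have hne : a - ζ ^ k * b ≠ 0 := fun h ↦ hab (by rw [sub_eq_zero.mp h, hpow])
    have hgeom : (∑ j ∈ range n, (ζ ^ j) ^ k * (b ^ j * a ^ (n - 1 - j))) * (a - ζ ^ k * b) =
        a ^ n - b ^ n := by
      have h := geom_sum₂_mul (ζ ^ k * b) a n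
      rw [hpow] at h
      have hsum : ∑ j ∈ range n, (ζ ^ j) ^ k * (b ^ j * a ^ (n - 1 - j)) =
          ∑ j ∈ range n, (ζ ^ k * b) ^ j * a ^ (n - 1 - j) :=
        sum_congr rfl fun j _ ↦ by rw [mul_pow, pow_right_comm ζ j k, mul_assoc]
      rw [hsum]
      linear_combination -h
    rw [eq_sub_iff_add_eq, div_add_one hne, div_eq_div_iff hne hd]
    linear_combination (-2 * a) * hgeom
  have hroots (j : ℕ) (hj : j ∈ range n) (hj0 : j ≠ 0) : ∑ k ∈ range n, (ζ ^ j) ^ k = 0 := by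
    have hne : ζ ^ j - 1 ≠ 0 :=
      sub_ne_zero.mpr (hζ.pow_ne_one_of_pos_of_lt hj0 (mem_range.mp hj))
    refine (mul_eq_zero.mp ?_).resolve_right hne
    rw [geom_sum_mul, ← pow_mul, mul_comm, pow_mul, hζ.pow_eq_one, one_pow, sub_self]
  rcases Nat.eq_zero_or_pos n with rfl | hn
  · simp
  have hdouble : ∑ k ∈ range n, ∑ j ∈ range n, (ζ ^ j) ^ k * (b ^ j * a ^ (n - 1 - j)) =
      n * a ^ (n - 1) := by
    rw [sum_comm]
    simp_rw [← sum_mul]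
    rw [sum_eq_single_of_mem 0 (mem_range.mpr hn)
      fun j hj hj0 ↦ by rw [hroots j hj hj0, zero_mul]]
    simp
  simp_rw [hterm]
  rw [sum_sub_distrib, ← sum_div, ← mul_sum, hdouble]
  obtain ⟨m, rfl⟩ : ∃ m, n = m + 1 := ⟨n - 1, by omega⟩
  simp only [sum_const, card_range, nsmul_eq_mul, mul_one, Nat.add_sub_cancel]
  field_simp
  ring

theorem one_sub_pow_lt_one_add_pow {n : ℕ} (hn : Odd n) {w : ℝ} (hw : 0 < w) :
    (1 - w) ^ n < (1 + w) ^ n :=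
  hn.strictMono_pow (by linarith)

theorem sum_div_sq_mul_cos_sq_add_sin_sq {n : ℕ} (hn : Odd n) {w : ℝ} (hw : 0 < w) :
    ∑ k ∈ range n, w / (w ^ 2 * Real.cos (k * Real.pi / n) ^ 2 + Real.sin (k * Real.pi / n) ^ 2) =
      n * ((1 + w) ^ n + (1 - w) ^ n) / ((1 + w) ^ n - (1 - w) ^ n) := by
  have hn0 : n ≠ 0 := hn.pos.ne'
  have hlt := one_sub_pow_lt_one_add_pow hn hw
  have hne : ((1 + w : ℝ) : ℂ) ^ n ≠ ((1 - w : ℝ) : ℂ) ^ n := by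
    exact_mod_cast hlt.ne'
  have h := congrArg Complex.re
    ((Complex.isPrimitiveRoot_exp n hn0).sum_add_div_sub hne)
  have hre : ((n : ℂ) * (((1 + w : ℝ) : ℂ) ^ n + ((1 - w : ℝ) : ℂ) ^ n) /
      (((1 + w : ℝ) : ℂ) ^ n - ((1 - w : ℝ) : ℂ) ^ n)).re =
      n * ((1 + w) ^ n + (1 - w) ^ n) / ((1 + w) ^ n - (1 - w) ^ n) := by
    exact_mod_cast Complex.ofReal_re
      (n * ((1 + w) ^ n + (1 - w) ^ n) / ((1 + w) ^ n - (1 - w) ^ n))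
  rw [hre, Complex.re_sum] at h
  rw [← h]
  refine sum_congr rfl fun k _ ↦ ?_
  set t : ℝ := k * Real.pi / n with ht
  have hsc := Real.sin_sq_add_cos_sq t
  set c := Real.cos t
  set s := Real.sin t
  have hexp : Complex.exp (2 * Real.pi * Complex.I / n) ^ k = (c + s * Complex.I) ^ 2 := by
    rw [Complex.ofReal_cos, Complex.ofReal_sin, ← Complex.exp_mul_I, ← Complex.exp_nat_mul,
      ← Complex.exp_nat_mul, ht]
    congr 1
    push_cast
    ring
  have hpos : 0 < w ^ 2 * c ^ 2 + s ^ 2 := by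
    rcases eq_or_ne c 0 with hc | hc
    · rw [hc] at hsc ⊢
      nlinarith
    · positivity
  have hscC : (s : ℂ) ^ 2 + (c : ℂ) ^ 2 = 1 := by exact_mod_cast hsc
  have hunit : ((c : ℂ) + s * Complex.I) * (c - s * Complex.I) = 1 := by
    linear_combination hscC - (s : ℂ) ^ 2 * Complex.I_sq
  have hquot : (((1 + w : ℝ) : ℂ) + (c + s * Complex.I) ^ 2 * ((1 - w : ℝ) : ℂ)) /
      (((1 + w : ℝ) : ℂ) - (c + s * Complex.I) ^ 2 * ((1 - w : ℝ) : ℂ)) =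
      (c - w * s * Complex.I) / (w * c - s * Complex.I) := by
    have hfac : (2 * ((c : ℂ) + s * Complex.I)) ≠ 0 :=
      mul_ne_zero two_ne_zero (left_ne_zero_of_mul_eq_one hunit)
    rw [← mul_div_mul_left ((c : ℂ) - w * s * Complex.I) _ hfac]
    push_cast
    congr 1
    · linear_combination -(1 + (w : ℂ)) * hunit
    · linear_combination -(1 + (w : ℂ)) * hunit
  rw [hexp, hquot, Complex.div_re]
  simp only [Complex.normSq_apply, Complex.sub_re, Complex.sub_im, Complex.mul_re, Complex.mul_im,
    Complex.ofReal_re, Complex.ofReal_im, Complex.I_re, Complex.I_im]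
  ring_nf
  ring_nf at hpos
  field_simp
  linear_combination -hsc

theorem sum_range_two_mul_add_one_of_symm {R : Type*} [Semiring R] (M : ℕ) (f : ℕ → R)
    (hf : ∀ k < M, f (2 * M + 1 - (k + 1)) = f (k + 1)) :
    ∑ k ∈ range (2 * M + 1), f k = f 0 + 2 * ∑ k ∈ range M, f (k + 1) := by
  have hsplit : ∑ k ∈ range (2 * M), f (k + 1) =
      ∑ k ∈ range M, f (k + 1) + ∑ k ∈ range M, f (M + k + 1) := by
    rw [two_mul, sum_range_add]
  have hrefl : ∑ k ∈ range M, f (M + k + 1) = ∑ k ∈ range M, f (k + 1) := by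
    rw [← sum_range_reflect]
    refine sum_congr rfl fun k hk ↦ ?_
    have hk := mem_range.mp hk
    rw [← hf k hk]
    congr 1
    omega
  rw [sum_range_succ', hsplit, hrefl, ← two_mul, add_comm]

theorem cos_succ_mul_pi_div_pos {M k : ℕ} (hk : k < M) :
    0 < Real.cos (((k : ℝ) + 1) * Real.pi / (2 * M + 1)) := by
  have hk' : (k : ℝ) + 1 ≤ M := by exact_mod_cast hk
  have hpi := Real.pi_pos
  apply Real.cos_pos_of_mem_Ioo
  constructor
  · have : 0 < ((k : ℝ) + 1) * Real.pi / (2 * M + 1) := by positivity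
    linarith
  · rw [div_lt_div_iff₀ (by positivity) two_pos]
    nlinarith

theorem one_add_two_mul_sum_tan (M : ℕ) {w : ℝ} (hw : 0 < w) :
    1 + 2 * ∑ k ∈ range M, w ^ 2 * (1 + Real.tan (((k : ℝ) + 1) * Real.pi / (2 * M + 1)) ^ 2) /
        (w ^ 2 + Real.tan (((k : ℝ) + 1) * Real.pi / (2 * M + 1)) ^ 2) =
      (2 * M + 1) * (w * ((1 + w) ^ (2 * M + 1) + (1 - w) ^ (2 * M + 1)) /
        ((1 + w) ^ (2 * M + 1) - (1 - w) ^ (2 * M + 1))) := by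
  have h := sum_div_sq_mul_cos_sq_add_sin_sq (odd_two_mul_add_one M) hw
  rw [sum_range_two_mul_add_one_of_symm] at h
  · push_cast at h
    have hrhs : (2 * M + 1) * (w * ((1 + w) ^ (2 * M + 1) + (1 - w) ^ (2 * M + 1)) /
        ((1 + w) ^ (2 * M + 1) - (1 - w) ^ (2 * M + 1))) =
        w * ((2 * M + 1) * ((1 + w) ^ (2 * M + 1) + (1 - w) ^ (2 * M + 1)) /
        ((1 + w) ^ (2 * M + 1) - (1 - w) ^ (2 * M + 1))) := by ring
    rw [hrhs, ← h, mul_add, mul_left_comm, mul_sum _ _ w]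
    congr 1
    · simp
      field_simp
    · congr 1
      refine sum_congr rfl fun k hk ↦ ?_
      have hc := cos_succ_mul_pi_div_pos (mem_range.mp hk)
      have hsc := Real.sin_sq_add_cos_sq (((k : ℝ) + 1) * Real.pi / (2 * M + 1))
      rw [Real.tan_eq_sin_div_cos]
      set c := Real.cos (((k : ℝ) + 1) * Real.pi / (2 * M + 1))
      set s := Real.sin (((k : ℝ) + 1) * Real.pi / (2 * M + 1))
      have h1 : 1 + (s / c) ^ 2 = 1 / c ^ 2 := by
        field_simp
        linarith
      have h2 : w ^ 2 + (s / c) ^ 2 = (w ^ 2 * c ^ 2 + s ^ 2) / c ^ 2 := by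
        field_simp
      rw [h1, h2]
      field_simp
  · intro k hk
    have harg : ((2 * M + 1 - (k + 1) : ℕ) : ℝ) * Real.pi / (2 * M + 1 : ℕ) =
        Real.pi - ((k + 1 : ℕ) : ℝ) * Real.pi / (2 * M + 1 : ℕ) := by
      rw [Nat.cast_sub (by omega)]
      push_cast
      field_simp
    rw [harg, Real.cos_pi_sub, Real.sin_pi_sub, neg_sq]

/-- The `w → ∞` limit of `one_add_two_mul_sum_tan`. -/
theorem one_add_two_mul_sum_one_add_tan_sq (M : ℕ) :
    1 + 2 * ∑ k ∈ range M, (1 + Real.tan (((k : ℝ) + 1) * Real.pi / (2 * M + 1)) ^ 2) =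
      (2 * M + 1 : ℝ) ^ 2 := by
  set n := 2 * M + 1 with hn
  have hodd : Odd n := odd_two_mul_add_one M
  set T : ℕ → ℝ := fun k ↦ Real.tan (((k : ℝ) + 1) * Real.pi / (2 * M + 1)) ^ 2
  have hleft : Tendsto (fun u : ℝ ↦ 1 + 2 * ∑ k ∈ range M, (1 + T k) / (1 + u ^ 2 * T k))
      (𝓝[>] 0) (𝓝 (1 + 2 * ∑ k ∈ range M, (1 + T k))) := by
    have hcont : ContinuousAt
        (fun u : ℝ ↦ 1 + 2 * ∑ k ∈ range M, (1 + T k) / (1 + u ^ 2 * T k)) 0 := by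
      refine continuousAt_const.add (continuousAt_const.mul (tendsto_finsetSum _ fun k _ ↦ ?_))
      exact ContinuousAt.div (by fun_prop) (by fun_prop) (by simp)
    simpa using hcont.tendsto.mono_left nhdsWithin_le_nhds
  have hright : Tendsto
      (fun u : ℝ ↦ (2 * M + 1) * ((u⁻¹ * ((1 + u) ^ n - (1 - u) ^ n)) /
        ((1 + u) ^ n + (1 - u) ^ n))) (𝓝[>] 0) (𝓝 ((2 * M + 1 : ℝ) ^ 2)) := by
    have hderiv : HasDerivAt (fun u : ℝ ↦ (1 + u) ^ n - (1 - u) ^ n) (2 * n) 0 := by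
      have h1 := ((hasDerivAt_id (0 : ℝ)).const_add 1).fun_pow n
      have h2 := ((hasDerivAt_id (0 : ℝ)).const_sub 1).fun_pow n
      refine (h1.fun_sub h2).congr_deriv ?_
      simp
      ring
    have hslope := hderiv.tendsto_slope_zero_right
    have hden : Tendsto (fun u : ℝ ↦ (1 + u) ^ n + (1 - u) ^ n) (𝓝[>] 0) (𝓝 2) := by
      have hcont : Continuous (fun u : ℝ ↦ (1 + u) ^ n + (1 - u) ^ n) := by fun_prop
      have h := (hcont.tendsto 0).mono_left (nhdsWithin_le_nhds (s := Set.Ioi 0))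
      norm_num at h
      exact h
    have h := (hslope.div hden two_ne_zero).const_mul (2 * M + 1 : ℝ)
    convert h using 2
    · simp
    · rw [hn]
      push_cast
      ring
  refine tendsto_nhds_unique hleft (hright.congr' ?_)
  filter_upwards [self_mem_nhdsWithin] with u hu
  have hu : 0 < u := hu
  have h := one_add_two_mul_sum_tan M (inv_pos.mpr hu)
  have hplus : 1 + u⁻¹ = (1 + u) / u := by field_simp; ring
  have hminus : 1 - u⁻¹ = -(1 - u) / u := by field_simp; ring
  rw [← hn, hplus, hminus, div_pow, div_pow, hodd.neg_pow] at h
  have hpow : u ^ n ≠ 0 := by positivity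
  have hrhs : u⁻¹ * ((1 + u) ^ n / u ^ n + -(1 - u) ^ n / u ^ n) /
      ((1 + u) ^ n / u ^ n - -(1 - u) ^ n / u ^ n) =
      u⁻¹ * ((1 + u) ^ n - (1 - u) ^ n) / ((1 + u) ^ n + (1 - u) ^ n) := by
    rw [← add_div, ← sub_div, ← mul_div_assoc, div_div_div_cancel_right₀ hpow]
    ring
  rw [hrhs] at h
  rw [← h]
  congr 2
  refine sum_congr rfl fun k _ ↦ ?_
  have hTk : 0 ≤ T k := sq_nonneg _
  change u⁻¹ ^ 2 * (1 + T k) / (u⁻¹ ^ 2 + T k) = _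
  field_simp


/-- Closed form of the diagonal Padé approximant of `√x`: with `ηₖ = tan(kπ/(2M+1))`,
`b₀ = 2M+1`, `bₖ = 2ηₖ²(1+ηₖ²)/(2M+1)`, for every `x > 0`, writing `w = √x`,
the denominator `(1+w)^{2M+1} - (1-w)^{2M+1}` is nonzero and
`R_M(x) = w((1+w)^{2M+1} + (1-w)^{2M+1}) / ((1+w)^{2M+1} - (1-w)^{2M+1})`. -/
theorem stmt8 (M : ℕ) (x : ℝ) (hx : 0 < x) :
    ((1 + Real.sqrt x) ^ (2 * M + 1) - (1 - Real.sqrt x) ^ (2 * M + 1) ≠ 0) ∧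
    ((2 * M + 1 : ℝ) - ∑ k ∈ Finset.range M,
        (2 * Real.tan (((k : ℝ) + 1) * Real.pi / (2 * M + 1)) ^ 2 *
            (1 + Real.tan (((k : ℝ) + 1) * Real.pi / (2 * M + 1)) ^ 2) / (2 * M + 1)) /
          (x + Real.tan (((k : ℝ) + 1) * Real.pi / (2 * M + 1)) ^ 2))
      = Real.sqrt x *
          ((1 + Real.sqrt x) ^ (2 * M + 1) + (1 - Real.sqrt x) ^ (2 * M + 1)) /
          ((1 + Real.sqrt x) ^ (2 * M + 1) - (1 - Real.sqrt x) ^ (2 * M + 1)) := by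
  have hw : 0 < Real.sqrt x := Real.sqrt_pos.mpr hx
  refine ⟨(sub_pos.mpr (one_sub_pow_lt_one_add_pow (odd_two_mul_add_one M) hw)).ne', ?_⟩
  have hpade := one_add_two_mul_sum_tan M hw
  rw [Real.sq_sqrt hx.le] at hpade
  have hsq := one_add_two_mul_sum_one_add_tan_sq M
  have hN : (2 * M + 1 : ℝ) ≠ 0 := by positivity
  apply mul_left_cancel₀ hN
  rw [← hpade, mul_sub, ← sq, ← hsq, mul_sum, mul_sum, mul_sum, add_sub_assoc,
    ← sum_sub_distrib]
  congr 1
  refine sum_congr rfl fun k _ ↦ ?_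
  have hden : x + Real.tan (((k : ℝ) + 1) * Real.pi / (2 * M + 1)) ^ 2 ≠ 0 := by positivity
  generalize Real.tan (((k : ℝ) + 1) * Real.pi / (2 * M + 1)) = t at hden ⊢
  field_simp
  ring
end

section
/- Let x > 0 be a real number. For M ∈ ℕ set θₖ = k·π/(2M+1), ηₖ = tan θₖ, b₀ = 2M+1, bₖ = 2·ηₖ²·(1+ηₖ²)/(2M+1) for k = 1, …, M, and R_M(x) = b₀ − Σ_{k=1}^{M} bₖ/(x + ηₖ²). Then R_M(x) converges to √x as M → ∞. -/
open Finset in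
/-- The simple-fraction sum over the `n`-th roots of unity. -/
theorem IsPrimitiveRoot.sum_inv_one_sub_mul_pow {K : Type*} [Field K] {ζ : K} {n : ℕ}
    (hζ : IsPrimitiveRoot ζ n) (hn : 0 < n) {q : K} (hq : q ^ n ≠ 1) :
    ∑ k ∈ range n, (1 - q * ζ ^ k)⁻¹ = n / (1 - q ^ n) := by
  have hq' : 1 - q ^ n ≠ 0 := sub_ne_zero.mpr hq.symm
  have key : ∀ k ∈ range n, (1 - q * ζ ^ k)⁻¹ =
      (∑ j ∈ range n, q ^ j * (ζ ^ j) ^ k) / (1 - q ^ n) := by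
    intro k _
    have hpow : (q * ζ ^ k) ^ n = q ^ n := by
      rw [mul_pow, ← pow_mul, mul_comm k, pow_mul, hζ.pow_eq_one, one_pow, mul_one]
    have hne : 1 - q * ζ ^ k ≠ 0 := by
      intro h
      rw [← sub_eq_zero.mp h, one_pow] at hpow
      exact hq hpow.symm
    have hgeom := mul_neg_geom_sum (q * ζ ^ k) n
    rw [hpow] at hgeom
    rw [eq_div_iff hq', inv_mul_eq_iff_eq_mul₀ hne, ← hgeom]
    congr 1
    refine sum_congr rfl fun j _ => ?_
    rw [mul_pow, ← pow_mul, ← pow_mul, mul_comm k]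
  rw [sum_congr rfl key, ← sum_div, sum_comm]
  congr 1
  rw [sum_eq_single 0]
  · simp
  · intro j hj hj0
    have hne : ζ ^ j ≠ 1 := hζ.pow_ne_one_of_pos_of_lt hj0 (mem_range.mp hj)
    have h := mul_neg_geom_sum (ζ ^ j) n
    rw [← pow_mul, mul_comm j, pow_mul, hζ.pow_eq_one, one_pow, sub_self] at h
    rw [← mul_sum, (mul_eq_zero.mp h).resolve_left (sub_ne_zero.mpr hne.symm), mul_zero]
  · intro h
    exact absurd (mem_range.mpr hn) h

open Finset in
/-- Obtained by differentiating `IsPrimitiveRoot.sum_inv_one_sub_mul_pow` at `q = -1`. -/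
theorem IsPrimitiveRoot.sum_pow_div_one_add_pow_sq {ζ : ℂ} {n : ℕ}
    (hζ : IsPrimitiveRoot ζ n) (hn : Odd n) :
    ∑ k ∈ range n, ζ ^ k / (1 + ζ ^ k) ^ 2 = (n : ℂ) ^ 2 / 4 := by
  have hq : (-1 : ℂ) ^ n ≠ 1 := by rw [hn.neg_one_pow]; norm_num
  have hne : ∀ k, 1 - (-1) * ζ ^ k ≠ 0 := by
    intro k h
    apply hq
    rw [show (-1 : ℂ) = ζ ^ k by linear_combination -h, ← pow_mul, mul_comm, pow_mul,
      hζ.pow_eq_one, one_pow]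
  have hev : (fun q : ℂ => ∑ k ∈ range n, (1 - q * ζ ^ k)⁻¹) =ᶠ[nhds (-1)]
      fun q => (n : ℂ) / (1 - q ^ n) := by
    have : ∀ᶠ q : ℂ in nhds (-1), q ^ n ≠ 1 :=
      (continuous_pow n).continuousAt.eventually_ne hq
    filter_upwards [this] with q hq
    exact hζ.sum_inv_one_sub_mul_pow hn.pos hq
  have h1 : HasDerivAt (fun q : ℂ => ∑ k ∈ range n, (1 - q * ζ ^ k)⁻¹)
      (∑ k ∈ range n, -(-(1 * ζ ^ k)) / (1 - (-1) * ζ ^ k) ^ 2) (-1) :=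
    HasDerivAt.fun_sum fun k _ =>
      (((hasDerivAt_id (-1 : ℂ)).mul_const (ζ ^ k)).const_sub 1).inv (hne k)
  have h2 := (((hasDerivAt_pow n (-1 : ℂ)).const_sub 1).inv
    (sub_ne_zero.mpr hq.symm)).const_mul (n : ℂ)
  have h := h1.unique (h2.congr_of_eventuallyEq hev)
  simp only [hn.neg_one_pow, (Nat.Odd.sub_odd hn odd_one).neg_one_pow] at h
  calc _ = _ := sum_congr rfl fun k _ => by ring
    _ = _ := h
    _ = _ := by norm_num; ring

theorem Complex.exp_two_mul_I_eq_tan {θ : ℝ} (h : Real.cos θ ≠ 0) :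
    Complex.exp (2 * θ * Complex.I) =
      (1 + Real.tan θ * Complex.I) / (1 - Real.tan θ * Complex.I) := by
  have hc : Complex.cos θ ≠ 0 := by exact_mod_cast h
  have hs := Complex.sin_sq_add_cos_sq (θ : ℂ)
  have hd : Complex.cos θ - Complex.sin θ * Complex.I ≠ 0 := by
    intro h0
    have : (Complex.cos θ - Complex.sin θ * Complex.I) *
        (Complex.cos θ + Complex.sin θ * Complex.I) = 1 := by
      linear_combination hs - Complex.sin θ ^ 2 * Complex.I_sq
    rw [h0, zero_mul] at this
    exact zero_ne_one this
  rw [show (2 * θ * Complex.I : ℂ) = θ * Complex.I + θ * Complex.I by ring, Complex.exp_add,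
    Complex.exp_mul_I, Complex.ofReal_tan, Complex.tan_eq_sin_div_cos,
    show (1 + Complex.sin θ / Complex.cos θ * Complex.I) =
      (Complex.cos θ + Complex.sin θ * Complex.I) / Complex.cos θ by field_simp,
    show (1 - Complex.sin θ / Complex.cos θ * Complex.I) =
      (Complex.cos θ - Complex.sin θ * Complex.I) / Complex.cos θ by field_simp,
    div_div_div_cancel_right₀ hc, eq_div_iff hd]
  linear_combination (Complex.cos θ + Complex.sin θ * Complex.I) *
    (hs - Complex.sin θ ^ 2 * Complex.I_sq)

theorem Real.cos_nat_mul_pi_div_ne_zero {n : ℕ} (hn : Odd n) (k : ℕ) :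
    Real.cos (k * Real.pi / n) ≠ 0 := by
  have hn0 : (n : ℝ) ≠ 0 := by exact_mod_cast hn.pos.ne'
  rw [Ne, Real.cos_eq_zero_iff]
  rintro ⟨m, hm⟩
  have h : (2 * k : ℝ) = (2 * m + 1) * n := by
    field_simp at hm
    linarith
  have h' : (2 * k : ℤ) = (2 * m + 1) * n := by exact_mod_cast h
  obtain ⟨j, rfl⟩ := hn
  have : Odd ((2 * m + 1) * ((2 * j + 1 : ℕ) : ℤ)) :=
    (odd_two_mul_add_one m).mul (by push_cast; exact odd_two_mul_add_one _)
  rw [← h'] at this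
  exact (Int.not_odd_iff_even.mpr (even_two_mul _)) this

theorem Complex.exp_two_pi_div_pow_eq_tan {n : ℕ} (hn : Odd n) (k : ℕ) :
    Complex.exp (2 * Real.pi * Complex.I / n) ^ k =
      (1 + Real.tan (k * Real.pi / n) * Complex.I) /
        (1 - Real.tan (k * Real.pi / n) * Complex.I) := by
  rw [← Complex.exp_two_mul_I_eq_tan (Real.cos_nat_mul_pi_div_ne_zero hn k), ← Complex.exp_nat_mul]
  congr 1
  push_cast
  ring

open Finset in
theorem Real.sum_range_tan_sq {n : ℕ} (hn : Odd n) :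
    ∑ k ∈ range n, Real.tan (k * Real.pi / n) ^ 2 = (n : ℝ) * (n - 1) := by
  have h := (Complex.isPrimitiveRoot_exp n hn.pos.ne').sum_pow_div_one_add_pow_sq hn
  have hterm : ∀ k ∈ range n, Complex.exp (2 * Real.pi * Complex.I / n) ^ k /
      (1 + Complex.exp (2 * Real.pi * Complex.I / n) ^ k) ^ 2 =
      (((1 + Real.tan (k * Real.pi / n) ^ 2) / 4 : ℝ) : ℂ) := by
    intro k _
    rw [Complex.exp_two_pi_div_pow_eq_tan hn]
    generalize Real.tan (k * Real.pi / n) = t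
    have hd : (1 - t * Complex.I : ℂ) ≠ 0 := fun h0 => by
      simpa using congrArg Complex.re h0
    push_cast
    rw [show 1 + (1 + t * Complex.I) / (1 - t * Complex.I) = 2 / (1 - t * Complex.I) by
      field_simp; ring]
    field_simp
    linear_combination (-4 * (t : ℂ) ^ 2) * Complex.I_sq
  rw [sum_congr rfl hterm] at h
  have h' : ∑ k ∈ range n, (1 + Real.tan (k * Real.pi / n) ^ 2) / 4 = (n : ℝ) ^ 2 / 4 := by
    apply Complex.ofReal_injective
    rw [Complex.ofReal_sum, h]
    push_cast
    rfl
  rw [← sum_div, sum_add_distrib] at h'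
  simp only [sum_const, card_range, nsmul_eq_mul, mul_one] at h'
  linarith

theorem abs_one_sub_div_one_add_lt_one {s : ℝ} (hs : 0 < s) : |(1 - s) / (1 + s)| < 1 := by
  rw [abs_lt, lt_div_iff₀ (by linarith), div_lt_iff₀ (by linarith)]
  constructor <;> linarith

open Finset in
theorem Real.sum_range_inv_add_tan_sq {n : ℕ} (hn : Odd n) {s : ℝ} (hs : 0 < s) :
    s ^ 2 * (1 - s ^ 2) * ∑ k ∈ range n, (s ^ 2 + Real.tan (k * Real.pi / n) ^ 2)⁻¹ =
      2 * s * n / (1 - ((1 - s) / (1 + s)) ^ n) - n * s * (1 + s) := by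
  have hs1 : (1 + s : ℝ) ≠ 0 := by positivity
  have hs1' : (1 + s : ℂ) ≠ 0 := by exact_mod_cast hs1
  set q : ℝ := (1 - s) / (1 + s) with hq
  have hqn : |q ^ n| < 1 := by
    rw [abs_pow]
    exact pow_lt_one₀ (abs_nonneg q) (abs_one_sub_div_one_add_lt_one hs) hn.pos.ne'
  have hqn1 : q ^ n ≠ 1 := fun h => by simp [h] at hqn
  have h := (Complex.isPrimitiveRoot_exp n hn.pos.ne').sum_inv_one_sub_mul_pow hn.pos
    (q := (q : ℂ)) (by exact_mod_cast hqn1)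
  have hterm : ∀ k ∈ range n,
      (1 - (q : ℂ) * Complex.exp (2 * Real.pi * Complex.I / n) ^ k)⁻¹.re =
      (1 + s) / 2 * (1 + s * (1 - s) * (s ^ 2 + Real.tan (k * Real.pi / n) ^ 2)⁻¹) := by
    intro k _
    rw [Complex.exp_two_pi_div_pow_eq_tan hn]
    generalize Real.tan (k * Real.pi / n) = t
    have hd : (1 - t * Complex.I : ℂ) ≠ 0 := fun h0 => by
      simpa using congrArg Complex.re h0
    have hd2 : (s - t * Complex.I : ℂ) ≠ 0 := fun h0 => by
      have := congrArg Complex.re h0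
      simp at this
      exact hs.ne' this
    have hpos : s ^ 2 + t ^ 2 ≠ 0 := by positivity
    have hposC : (s ^ 2 + t ^ 2 : ℂ) ≠ 0 := by exact_mod_cast hpos
    have e : (1 - (q : ℂ) * ((1 + t * Complex.I) / (1 - t * Complex.I)))⁻¹ =
        (((1 + s) / 2 * (1 + s * (1 - s) * (s ^ 2 + t ^ 2)⁻¹) : ℝ) : ℂ) +
          (((1 + s) / 2 * (t * (1 - s)) * (s ^ 2 + t ^ 2)⁻¹ : ℝ) : ℂ) * Complex.I := by
      have e1 : 1 - (q : ℂ) * ((1 + t * Complex.I) / (1 - t * Complex.I)) =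
          2 * (s - t * Complex.I) / ((1 + s) * (1 - t * Complex.I)) := by
        rw [hq]
        push_cast
        field_simp
        ring
      rw [e1, inv_div]
      push_cast
      field_simp
      linear_combination (-(t : ℂ) ^ 2 * (s - 1)) * Complex.I_sq
    rw [e, Complex.add_re, Complex.ofReal_re, Complex.re_ofReal_mul, Complex.I_re, mul_zero,
      add_zero]
  have h' := congrArg Complex.re h
  rw [Complex.re_sum, sum_congr rfl hterm,
    show (n : ℂ) / (1 - (q : ℂ) ^ n) = ((n / (1 - q ^ n) : ℝ) : ℂ) by push_cast; rfl,
    Complex.ofReal_re, ← mul_sum, sum_add_distrib, ← mul_sum] at h'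
  simp only [sum_const, card_range, nsmul_eq_mul, mul_one] at h'
  rw [mul_div_assoc (2 * s), ← h']
  ring

open Finset in
theorem sum_range_two_mul_add_one_of_reflect {f : ℕ → ℝ} {M : ℕ}
    (hf : ∀ k ≤ 2 * M + 1, f (2 * M + 1 - k) = f k) :
    ∑ k ∈ range (2 * M + 1), f k = f 0 + 2 * ∑ k ∈ range M, f (k + 1) := by
  rw [sum_range_succ', two_mul M, sum_range_add, ← sum_range_reflect (fun k => f (M + k + 1))]
  have : ∑ j ∈ range M, f (M + (M - 1 - j) + 1) = ∑ j ∈ range M, f (j + 1) := by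
    refine sum_congr rfl fun j hj => ?_
    have := mem_range.mp hj
    rw [← hf (j + 1) (by omega)]
    congr 1
    omega
  rw [this]
  ring

theorem Real.tan_sq_reflect {n k : ℕ} (hn : 0 < n) (hk : k ≤ n) :
    Real.tan (((n - k : ℕ) : ℝ) * Real.pi / n) ^ 2 = Real.tan (k * Real.pi / n) ^ 2 := by
  have hn0 : (n : ℝ) ≠ 0 := by exact_mod_cast hn.ne'
  rw [Nat.cast_sub hk, show ((n : ℝ) - k) * Real.pi / n = Real.pi - k * Real.pi / n by
    field_simp, Real.tan_pi_sub, neg_sq]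

open Finset in
/-- Closed form of the diagonal Padé approximant of the square root, in terms of `s = √x`. -/
theorem sub_sum_pade_eq {s : ℝ} (hs : 0 < s) (M : ℕ) :
    (2 * M + 1 : ℝ) - ∑ k ∈ range M,
        (2 * Real.tan (((k : ℝ) + 1) * Real.pi / (2 * M + 1)) ^ 2 *
            (1 + Real.tan (((k : ℝ) + 1) * Real.pi / (2 * M + 1)) ^ 2) / (2 * M + 1)) /
          (s ^ 2 + Real.tan (((k : ℝ) + 1) * Real.pi / (2 * M + 1)) ^ 2) =
      2 * s / (1 - ((1 - s) / (1 + s)) ^ (2 * M + 1)) - s := by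
  have hodd : Odd (2 * M + 1) := odd_two_mul_add_one M
  have hT := Real.sum_range_tan_sq hodd
  have hI := Real.sum_range_inv_add_tan_sq hodd hs
  rw [sum_range_two_mul_add_one_of_reflect
    fun k hk => Real.tan_sq_reflect hodd.pos hk] at hT
  rw [sum_range_two_mul_add_one_of_reflect
    fun k hk => by rw [Real.tan_sq_reflect hodd.pos hk]] at hI
  push_cast at hT hI
  simp only [zero_mul, zero_div, Real.tan_zero, ne_eq, OfNat.ofNat_ne_zero, not_false_eq_true,
    zero_pow, add_zero, zero_add] at hT hI
  have hn : (2 * M + 1 : ℝ) ≠ 0 := by positivity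
  have hterm : ∀ k ∈ range M,
      (2 * Real.tan (((k : ℝ) + 1) * Real.pi / (2 * M + 1)) ^ 2 *
          (1 + Real.tan (((k : ℝ) + 1) * Real.pi / (2 * M + 1)) ^ 2) / (2 * M + 1)) /
        (s ^ 2 + Real.tan (((k : ℝ) + 1) * Real.pi / (2 * M + 1)) ^ 2) =
      2 / (2 * M + 1) * (Real.tan (((k : ℝ) + 1) * Real.pi / (2 * M + 1)) ^ 2 + (1 - s ^ 2) -
        s ^ 2 * (1 - s ^ 2) *
          (s ^ 2 + Real.tan (((k : ℝ) + 1) * Real.pi / (2 * M + 1)) ^ 2)⁻¹) := by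
    intro k _
    generalize Real.tan (((k : ℝ) + 1) * Real.pi / (2 * M + 1)) = t
    have hpos : s ^ 2 + t ^ 2 ≠ 0 := by positivity
    field_simp
    ring
  rw [sum_congr rfl hterm, ← mul_sum, sum_sub_distrib, sum_add_distrib, ← mul_sum]
  simp only [sum_const, card_range, nsmul_eq_mul]
  have hx : s ^ 2 * (s ^ 2)⁻¹ = 1 := mul_inv_cancel₀ (by positivity)
  rw [mul_div_right_comm] at hI
  generalize (∑ k ∈ range M, Real.tan (((k : ℝ) + 1) * Real.pi / (2 * M + 1)) ^ 2) = T at *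
  generalize (∑ k ∈ range M,
    (s ^ 2 + Real.tan (((k : ℝ) + 1) * Real.pi / (2 * M + 1)) ^ 2)⁻¹) = S at *
  generalize 2 * s / (1 - ((1 - s) / (1 + s)) ^ (2 * M + 1)) = D at *
  have e : 2 / (2 * M + 1 : ℝ) * (T + M * (1 - s ^ 2) - s ^ 2 * (1 - s ^ 2) * S) =
      2 * M + 1 - (D - s) := by
    rw [div_mul_eq_mul_div, div_eq_iff hn]
    linear_combination hT - hI + (1 - s ^ 2) * hx
  rw [e]
  ring


/-- Convergence of the diagonal Padé approximants: for every `x > 0`,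
`R_M(x) = (2M+1) - Σ_{k=1}^{M} bₖ/(x + ηₖ²)` converges to `√x` as `M → ∞`. -/
theorem stmt9 (x : ℝ) (hx : 0 < x) :
    Filter.Tendsto (fun M : ℕ =>
      (2 * M + 1 : ℝ) - ∑ k ∈ Finset.range M,
        (2 * Real.tan (((k : ℝ) + 1) * Real.pi / (2 * M + 1)) ^ 2 *
            (1 + Real.tan (((k : ℝ) + 1) * Real.pi / (2 * M + 1)) ^ 2) / (2 * M + 1)) /
          (x + Real.tan (((k : ℝ) + 1) * Real.pi / (2 * M + 1)) ^ 2))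
      Filter.atTop (nhds (Real.sqrt x)) := by
  have hs : 0 < Real.sqrt x := Real.sqrt_pos.mpr hx
  have heq := sub_sum_pade_eq hs
  rw [Real.sq_sqrt hx.le] at heq
  have hodd : Filter.Tendsto (fun M : ℕ => 2 * M + 1) Filter.atTop Filter.atTop :=
    Filter.tendsto_atTop_mono (fun M => show M ≤ 2 * M + 1 by omega) Filter.tendsto_id
  have hq := (tendsto_pow_atTop_nhds_zero_of_abs_lt_one
    (abs_one_sub_div_one_add_lt_one hs)).comp hodd
  have hlim := ((tendsto_const_nhds (x := 2 * Real.sqrt x)).div (hq.const_sub 1)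
    (by norm_num)).sub_const (Real.sqrt x)
  rw [show 2 * Real.sqrt x / (1 - 0) - Real.sqrt x = Real.sqrt x by ring] at hlim
  exact hlim.congr fun M => (heq M).symm
end

section
/- Let f : ℝ → ℂ be continuous. Then for every t > 0, ∫₀ᵗ (t−s)^(−1/2) · (∫₀ˢ (s−r)^(−1/2) · f(r) dr) ds = π · ∫₀ᵗ f(r) dr. Equivalently, the Riemann–Liouville half-order integral ∂ₜ^(−1/2)f(t) = (1/√π)·∫₀ᵗ f(s)/√(t−s) ds satisfies the semigroup property ∂ₜ^(−1/2)(∂ₜ^(−1/2)f)(t) = ∫₀ᵗ f(r) dr. -/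
open MeasureTheory Set

/-- The real power `x ^ (-1/2)` vanishes for nonpositive `x`. -/
lemma rpow_neg_half_of_nonpos {x : ℝ} (hx : x ≤ 0) : x ^ (-(1/2) : ℝ) = 0 := by
  rcases hx.eq_or_lt with rfl | hx
  · exact Real.zero_rpow (by norm_num)
  · rw [Real.rpow_def_of_neg hx, neg_mul, Real.cos_neg, one_div_mul_eq_div, Real.cos_pi_div_two,
      mul_zero]

lemma rpow_neg_half_nonneg (x : ℝ) : 0 ≤ x ^ (-(1/2) : ℝ) := by
  rcases le_total x 0 with hx | hx
  · exact (rpow_neg_half_of_nonpos hx).ge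
  · exact Real.rpow_nonneg hx _

lemma betaIntegral_half_half : Complex.betaIntegral (1/2) (1/2) = Real.pi := by
  have h := Complex.Gamma_mul_Gamma_eq_betaIntegral (s := 1/2) (t := 1/2) (by norm_num)
    (by norm_num)
  rw [add_halves, Complex.Gamma_one, one_mul, Complex.Gamma_one_half_eq, ← Complex.cpow_add _ _
    (by exact_mod_cast Real.pi_ne_zero), add_halves, Complex.cpow_one] at h
  exact h.symm

lemma integral_rpow_neg_half_mul {a : ℝ} (ha : 0 < a) :
    ∫ x in (0:ℝ)..a, (a - x) ^ (-(1/2) : ℝ) * x ^ (-(1/2) : ℝ) = Real.pi := by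
  have h := Complex.betaIntegral_scaled (1/2) (1/2) ha
  rw [betaIntegral_half_half, add_halves, sub_self, Complex.cpow_zero, one_mul] at h
  rw [← Complex.ofReal_inj, ← intervalIntegral.integral_ofReal, ← h]
  refine intervalIntegral.integral_congr fun x hx => ?_
  rw [uIcc_of_le ha.le] at hx
  simp only [Complex.ofReal_mul]
  rw [Complex.ofReal_cpow (sub_nonneg.2 hx.2), Complex.ofReal_cpow hx.1, mul_comm]
  push_cast
  norm_num

lemma setIntegral_rpow_neg_half_mul {r t : ℝ} (hr : 0 < r) (hrt : r < t) :
    ∫ s in Ioc 0 t, (t - s) ^ (-(1/2) : ℝ) * (s - r) ^ (-(1/2) : ℝ) = Real.pi := by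
  rw [← integral_rpow_neg_half_mul (sub_pos.2 hrt)]
  have h := intervalIntegral.integral_comp_sub_right (a := r) (b := t)
    (fun x => (t - r - x) ^ (-(1/2) : ℝ) * x ^ (-(1/2) : ℝ)) r
  rw [sub_self] at h
  rw [← h, intervalIntegral.integral_of_le hrt.le]
  simp only [sub_sub_sub_cancel_right]
  refine setIntegral_eq_of_subset_of_forall_sdiff_eq_zero measurableSet_Ioc
    (Ioc_subset_Ioc_left hr.le) fun s hs => ?_
  have : s ≤ r := not_lt.1 fun hs' => hs.2 ⟨hs', hs.1.2⟩
  rw [rpow_neg_half_of_nonpos (sub_nonpos.2 this), mul_zero]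

lemma integrableOn_rpow_neg_half_mul {r t : ℝ} (hr : 0 < r) (hrt : r < t) :
    IntegrableOn (fun s => (t - s) ^ (-(1/2) : ℝ) * (s - r) ^ (-(1/2) : ℝ)) (Ioc 0 t) :=
  not_imp_comm.1 integral_undef <| by
    rw [setIntegral_rpow_neg_half_mul hr hrt]; exact Real.pi_ne_zero

lemma integrable_prod_rpow_neg_half {f : ℝ → ℂ} (hf : Continuous f) (t : ℝ) :
    Integrable (fun p : ℝ × ℝ =>
        ((p.1 - p.2) ^ (-(1/2) : ℝ) * (t - p.1) ^ (-(1/2) : ℝ)) • f p.2)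
      ((volume.restrict (Ioc 0 t)).prod (volume.restrict (Ioc 0 t))) := by
  have hmem : ∀ᵐ r ∂volume.restrict (Ioc 0 t), 0 < r ∧ r < t := by
    rw [← restrict_Ioo_eq_restrict_Ioc]
    exact ae_restrict_mem measurableSet_Ioo
  have hmeas : Measurable fun p : ℝ × ℝ =>
      ((p.1 - p.2) ^ (-(1/2) : ℝ) * (t - p.1) ^ (-(1/2) : ℝ)) • f p.2 := by
    have := hf.measurable
    fun_prop
  rw [integrable_prod_iff' hmeas.aestronglyMeasurable]
  refine ⟨?_, ?_⟩
  · filter_upwards [hmem] with r hr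
    simp only [mul_comm ((_ - r) ^ (-(1/2) : ℝ))]
    exact (integrableOn_rpow_neg_half_mul hr.1 hr.2).smul_const (f r)
  · have hint : Integrable (fun r => Real.pi * ‖f r‖) (volume.restrict (Ioc 0 t)) :=
      ((by fun_prop : Continuous fun r => Real.pi * ‖f r‖).integrableOn_Icc).mono_set
        Ioc_subset_Icc_self
    refine hint.congr ?_
    filter_upwards [hmem] with r hr
    rw [← setIntegral_rpow_neg_half_mul hr.1 hr.2, ← integral_mul_const]
    refine integral_congr_ae (Filter.Eventually.of_forall fun s => ?_)
    simp only [norm_smul, Real.norm_eq_abs, mul_comm ((s - r) ^ (-(1/2) : ℝ))]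
    rw [abs_of_nonneg (mul_nonneg (rpow_neg_half_nonneg _) (rpow_neg_half_nonneg _))]


/-- Semigroup property of the half-order Riemann–Liouville integral: for continuous
`f : ℝ → ℂ` and `t > 0`,
`∫₀ᵗ (t-s)^(-1/2) (∫₀ˢ (s-r)^(-1/2) f(r) dr) ds = π ∫₀ᵗ f(r) dr`. -/
theorem stmt10 (f : ℝ → ℂ) (hf : Continuous f) :
    ∀ t : ℝ, 0 < t →
      (∫ s in (0:ℝ)..t, ((t - s) ^ (-(1/2) : ℝ) : ℝ) •
          (∫ r in (0:ℝ)..s, ((s - r) ^ (-(1/2) : ℝ) : ℝ) • f r))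
        = Real.pi • ∫ r in (0:ℝ)..t, f r := by
  intro t ht
  have hinner : ∀ s ∈ Ioc 0 t, (∫ r in (0:ℝ)..s, ((s - r) ^ (-(1/2) : ℝ) : ℝ) • f r) =
      ∫ r in Ioc 0 t, ((s - r) ^ (-(1/2) : ℝ) : ℝ) • f r := fun s hs => by
    rw [intervalIntegral.integral_of_le hs.1.le]
    refine (setIntegral_eq_of_subset_of_forall_sdiff_eq_zero measurableSet_Ioc
      (Ioc_subset_Ioc_right hs.2) fun r hr => ?_).symm
    have : s ≤ r := not_lt.1 fun h => hr.2 ⟨hr.1.1, h.le⟩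
    rw [rpow_neg_half_of_nonpos (sub_nonpos.2 this), zero_smul]
  rw [intervalIntegral.integral_of_le ht.le, intervalIntegral.integral_of_le ht.le,
    ← integral_smul]
  calc _ = ∫ s in Ioc 0 t, ∫ r in Ioc 0 t,
        ((s - r) ^ (-(1/2) : ℝ) * (t - s) ^ (-(1/2) : ℝ)) • f r := by
        refine setIntegral_congr_fun measurableSet_Ioc fun s hs => ?_
        simp only [hinner s hs, ← integral_smul, smul_smul, mul_comm ((t - s) ^ (-(1/2) : ℝ))]
    _ = ∫ r in Ioc 0 t, ∫ s in Ioc 0 t,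
        ((s - r) ^ (-(1/2) : ℝ) * (t - s) ^ (-(1/2) : ℝ)) • f r :=
        integral_integral_swap (integrable_prod_rpow_neg_half hf t)
    _ = ∫ r in Ioc 0 t, Real.pi • f r := by
        rw [← restrict_Ioo_eq_restrict_Ioc]
        refine setIntegral_congr_fun measurableSet_Ioo fun r hr => ?_
        simp only [restrict_Ioo_eq_restrict_Ioc, integral_smul_const,
          mul_comm ((_ - r) ^ (-(1/2) : ℝ)), setIntegral_rpow_neg_half_mul hr.1 hr.2]
end

section
/- Let λ ∈ ℝ and let f : ℝ → ℂ be continuously differentiable on [0,∞) with f(0) = 0. Define F(t) = exp(−i·λ·t) · ∫₀ᵗ exp(i·λ·s) · f(s) · (t−s)^(−1/2) ds. Then for every t > 0, F is differentiable at t and F'(t) = exp(−i·λ·t) · ∫₀ᵗ exp(i·λ·s) · f'(s) · (t−s)^(−1/2) ds. In operator form: ∂ₜ[e^{−iλt}·∂ₜ^(−1/2)(e^{iλt}·f)] = e^{−iλt}·∂ₜ^(−1/2)(e^{iλt}·∂ₜf). -/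
open MeasureTheory Set Filter Topology

/-- If `f` is `C¹` on `[0,∞)` with `f 0 = 0`, the causal convolution of `f` with a locally
integrable kernel `k` may be differentiated by differentiating `f`. -/
theorem hasDerivAt_integral_kernel_mul_comp_sub {k f f' : ℝ → ℂ}
    (hk : ∀ T : ℝ, IntervalIntegrable k volume 0 T)
    (hderiv : ∀ t ∈ Ici (0 : ℝ), HasDerivWithinAt f (f' t) (Ici 0) t)
    (hcont : ContinuousOn f' (Ici 0)) (hf0 : f 0 = 0) {t : ℝ} (ht : 0 < t) :
    HasDerivAt (fun x : ℝ => ∫ u in (0 : ℝ)..x, k u * f (x - u))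
      (∫ u in (0 : ℝ)..t, k u * f' (t - u)) t := by
  have hmax : Continuous fun x : ℝ => max x 0 := by fun_prop
  have hfc : Continuous fun x : ℝ => f (max x 0) :=
    ContinuousOn.comp_continuous (fun x hx => (hderiv x hx).continuousWithinAt) hmax
      fun x => mem_Ici.mpr (le_max_right x 0)
  have hfc' : Continuous fun x : ℝ => f' (max x 0) :=
    hcont.comp_continuous hmax fun x => mem_Ici.mpr (le_max_right x 0)
  have hneg : ∀ x : ℝ, x ≤ 0 → f (max x 0) = 0 := fun x hx => by rw [max_eq_right hx, hf0]
  have hsplit : ∀ (g h : ℝ → ℂ) (x : ℝ), 0 < x → x < t + 1 →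
      IntervalIntegrable g volume 0 (t + 1) →
      (∀ u, 0 < u → u < x → g u = h u) → (∀ u, x < u → g u = 0) →
      ∫ u in (0 : ℝ)..(t + 1), g u = ∫ u in (0 : ℝ)..x, h u := by
    intro g h x hx hxT hg hgh hg0
    have h₁ : IntervalIntegrable g volume 0 x := hg.mono_set (by
      rw [uIcc_of_le hx.le, uIcc_of_le (by linarith)]; exact Icc_subset_Icc_right hxT.le)
    have h₂ : IntervalIntegrable g volume x (t + 1) := hg.mono_set (by
      rw [uIcc_of_le hxT.le, uIcc_of_le (by linarith)]; exact Icc_subset_Icc_left hx.le)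
    have hz : ∫ u in x..(t + 1), g u = 0 := by
      apply intervalIntegral.integral_zero_ae
      refine Eventually.of_forall fun u hu => ?_
      rw [uIoc_of_le hxT.le] at hu
      exact hg0 u hu.1
    rw [← intervalIntegral.integral_add_adjacent_intervals h₁ h₂, hz, add_zero]
    apply intervalIntegral.integral_congr_ae
    filter_upwards [compl_mem_ae_iff.mpr (measure_singleton x)] with u hux hu
    rw [uIoc_of_le hx.le] at hu
    exact hgh u hu.1 (lt_of_le_of_ne hu.2 hux)
  have hint : ∀ x : ℝ, IntervalIntegrable (fun u => k u * f (max (x - u) 0)) volume 0 (t + 1) :=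
    fun x => (hk (t + 1)).mul_continuousOn
      (hfc.comp (continuous_const.sub continuous_id)).continuousOn
  obtain ⟨C, hC⟩ := isCompact_Icc.exists_bound_of_continuousOn
    (hcont.mono (Icc_subset_Ici_self : Icc 0 (t + 1) ⊆ Ici 0))
  have hlip : ∀ x ∈ Icc 0 (t + 1), ∀ y ∈ Icc 0 (t + 1), ‖f y - f x‖ ≤ C * ‖y - x‖ :=
    fun x hx y hy => (convex_Icc 0 (t + 1)).norm_image_sub_le_of_norm_hasDerivWithin_le
      (fun z hz => (hderiv z hz.1).mono Icc_subset_Ici_self) hC hx hy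
  have hC0 : 0 ≤ C := (norm_nonneg _).trans (hC 0 ⟨le_rfl, by linarith⟩)
  have key := intervalIntegral.hasDerivAt_integral_of_dominated_loc_of_lip
    (μ := volume) (a := 0) (b := t + 1) (x₀ := t) (s := Ioo 0 (t + 1))
    (F := fun x u => k u * f (max (x - u) 0))
    (F' := (Iio t).indicator fun u => k u * f' (max (t - u) 0))
    (bound := fun u => ‖k u‖ * C)
    (Ioo_mem_nhds ht (by linarith))
    (Eventually.of_forall fun x => (hint x).def'.aestronglyMeasurable)
    (hint t)
    (((hk (t + 1)).mul_continuousOn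
      (hfc'.comp (continuous_const.sub continuous_id)).continuousOn).def'.aestronglyMeasurable.indicator
        measurableSet_Iio)
    (by
      refine Eventually.of_forall fun u hu => ?_
      rw [uIoc_of_le (by linarith)] at hu
      refine LipschitzOnWith.of_dist_le_mul fun x hx y hy => ?_
      have hm : ∀ z ∈ Ioo 0 (t + 1), max (z - u) 0 ∈ Icc 0 (t + 1) := fun z hz =>
        ⟨le_max_right _ _, max_le (by linarith [hz.2, hu.1]) (by linarith)⟩
      have h1 := hlip _ (hm y hy) _ (hm x hx)
      have h2 : |max (x - u) 0 - max (y - u) 0| ≤ |x - y| := by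
        simpa using abs_max_sub_max_le_abs (x - u) (y - u) 0
      rw [dist_eq_norm, ← mul_sub, norm_mul, Real.coe_nnabs, abs_mul, abs_norm, abs_of_nonneg hC0,
        mul_assoc, Real.dist_eq]
      gcongr
      exact h1.trans (by rw [Real.norm_eq_abs]; gcongr))
    ((hk (t + 1)).norm.mul_const C)
    (by
      filter_upwards [compl_mem_ae_iff.mpr (measure_singleton t)] with u hut _
      rcases lt_or_gt_of_ne (show u ≠ t from hut) with h | h
      · rw [indicator_of_mem (show u ∈ Iio t from h), max_eq_left (by linarith)]
        have h1 : HasDerivAt f (f' (t - u)) (t - u) :=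
          (hderiv (t - u) (by simpa using h.le)).hasDerivAt (Ici_mem_nhds (by linarith))
        refine ((h1.comp_sub_const t u).const_mul (k u)).congr_of_eventuallyEq ?_
        filter_upwards [Ioi_mem_nhds h] with x hx
        rw [max_eq_left (by linarith [mem_Ioi.mp hx])]
      · rw [indicator_of_notMem (by simpa using h.le)]
        refine (hasDerivAt_const t (0 : ℂ)).congr_of_eventuallyEq ?_
        filter_upwards [Iio_mem_nhds h] with x hx
        rw [hneg _ (by linarith [mem_Iio.mp hx]), mul_zero])
  obtain ⟨hF'int, hd⟩ := key
  rw [hsplit _ (fun u => k u * f' (t - u)) t ht (by linarith) hF'int] at hd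
  · refine hd.congr_of_eventuallyEq ?_
    filter_upwards [Ioo_mem_nhds ht (show t < t + 1 by linarith)] with x hx
    refine (hsplit _ _ x hx.1 hx.2 (hint x) (fun u _ hu => ?_) fun u hu => ?_).symm
    · rw [max_eq_left (by linarith)]
    · rw [hneg _ (by linarith), mul_zero]
  · intro u _ hu
    rw [indicator_of_mem (show u ∈ Iio t from hu), max_eq_left (by linarith)]
  · intro u hu
    rw [indicator_of_notMem (by simpa using hu.le)]

/-- Reflecting `s ↦ t - s` turns the modulated half-integral into a causal convolution. -/
theorem exp_mul_integral_rpow_eq_integral_kernel_mul (lam : ℝ) (g : ℝ → ℂ) (t : ℝ) :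
    Complex.exp (-Complex.I * (lam : ℂ) * (t : ℂ)) *
      (∫ s in (0:ℝ)..t, Complex.exp (Complex.I * (lam : ℂ) * (s : ℂ)) * g s *
        (((t - s) ^ (-(1/2) : ℝ) : ℝ) : ℂ)) =
    ∫ u in (0:ℝ)..t, Complex.exp (-Complex.I * (lam : ℂ) * (u : ℂ)) *
      ((u ^ (-(1/2) : ℝ) : ℝ) : ℂ) * g (t - u) := by
  rw [← intervalIntegral.integral_const_mul]
  have h := intervalIntegral.integral_comp_sub_left (a := 0) (b := t)
    (fun u : ℝ => Complex.exp (-Complex.I * (lam : ℂ) * (u : ℂ)) *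
      ((u ^ (-(1/2) : ℝ) : ℝ) : ℂ) * g (t - u)) t
  rw [sub_self, sub_zero] at h
  rw [← h]
  congr 1
  funext s
  have he : Complex.exp (-Complex.I * (lam : ℂ) * ((t - s : ℝ) : ℂ)) =
      Complex.exp (-Complex.I * (lam : ℂ) * (t : ℂ)) *
        Complex.exp (Complex.I * (lam : ℂ) * (s : ℂ)) := by
    rw [← Complex.exp_add]
    congr 1
    push_cast
    ring
  rw [he, sub_sub_cancel]
  ring

/-- Commutation identity from the calculus of fractional operators: for
`F(t) = e^{-iλt} ∫₀ᵗ e^{iλs} f(s) (t-s)^(-1/2) ds` with `f` continuously differentiable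
on `[0,∞)` and `f(0) = 0`, one has
`F'(t) = e^{-iλt} ∫₀ᵗ e^{iλs} f'(s) (t-s)^(-1/2) ds` for every `t > 0`. -/
theorem stmt11 (lam : ℝ) (f f' : ℝ → ℂ)
    (hderiv : ∀ t ∈ Set.Ici (0 : ℝ), HasDerivWithinAt f (f' t) (Set.Ici 0) t)
    (hcont : ContinuousOn f' (Set.Ici 0))
    (hf0 : f 0 = 0)
    (F : ℝ → ℂ)
    (hF : ∀ t : ℝ, F t = Complex.exp (-Complex.I * (lam : ℂ) * (t : ℂ)) *
      ∫ s in (0:ℝ)..t, Complex.exp (Complex.I * (lam : ℂ) * (s : ℂ)) * f s *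
        (((t - s) ^ (-(1/2) : ℝ) : ℝ) : ℂ)) :
    ∀ t : ℝ, 0 < t → HasDerivAt F
      (Complex.exp (-Complex.I * (lam : ℂ) * (t : ℂ)) *
        ∫ s in (0:ℝ)..t, Complex.exp (Complex.I * (lam : ℂ) * (s : ℂ)) * f' s *
          (((t - s) ^ (-(1/2) : ℝ) : ℝ) : ℂ)) t := by
  intro t ht
  have hk : ∀ T : ℝ, IntervalIntegrable (fun u : ℝ =>
      Complex.exp (-Complex.I * (lam : ℂ) * (u : ℂ)) * ((u ^ (-(1/2) : ℝ) : ℝ) : ℂ)) volume 0 T :=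
    fun T => by
      have h : IntervalIntegrable (fun u : ℝ => u ^ (-(1/2) : ℝ)) volume 0 T :=
        intervalIntegral.intervalIntegrable_rpow' (by norm_num)
      have h' : IntervalIntegrable (fun u : ℝ => ((u ^ (-(1/2) : ℝ) : ℝ) : ℂ)) volume 0 T :=
        ⟨h.1.ofReal, h.2.ofReal⟩
      exact h'.continuousOn_mul (by fun_prop)
  rw [exp_mul_integral_rpow_eq_integral_kernel_mul]
  refine (hasDerivAt_integral_kernel_mul_comp_sub hk hderiv hcont hf0 ht).congr_of_eventuallyEq
    (Eventually.of_forall fun x => ?_)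
  rw [hF, exp_mul_integral_rpow_eq_integral_kernel_mul]
end

section
/- Let ν ∈ ℝ and define the sequence ω : ℕ → ℝ by ω₀ = 1, ω₁ = −2ν, and the recurrence (k+1)·ω_{k+1} = (k−1)·ω_{k−1} − 2ν·ω_k for all k ≥ 1. Then for every ξ ∈ ℝ with |ξ| < 1, the series Σ_{k=0}^∞ ω_k·ξ^k converges to ((1−ξ)/(1+ξ))^ν (real power of the positive real number (1−ξ)/(1+ξ)). -/
/-- Sequences obeying the recurrence of the trapezoidal weights grow at most polynomially. -/
lemma abs_weight_le_choose (ν : ℝ) (ω : ℕ → ℝ) (m : ℕ) (hm : 2 * |ν| ≤ m)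
    (h0 : ω 0 = 1) (h1 : ω 1 = -2 * ν)
    (hrec : ∀ k : ℕ, 1 ≤ k →
      ((k : ℝ) + 1) * ω (k + 1) = ((k : ℝ) - 1) * ω (k - 1) - 2 * ν * ω k) (k : ℕ) :
    |ω k| ≤ ((k + m).choose m : ℝ) := by
  induction k using Nat.twoStepInduction with
  | zero => simp [h0]
  | one =>
    have h : (1 + m).choose m = m + 1 := by rw [add_comm, Nat.choose_succ_self_right]
    rw [h1, h, abs_mul]
    push_cast
    norm_num
    linarith
  | more n ih0 ih1 =>
    have hr := hrec (n + 1) (by omega)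
    rw [Nat.add_sub_cancel] at hr
    push_cast at hr
    have hc : (((n + 1 + 1 + m).choose m : ℕ) : ℝ) * (n + 2)
        = (n + 2 + m) * ((n + 1 + m).choose m : ℕ) := by
      have h := Nat.choose_mul_succ_eq (n + 1 + m) m
      rw [show n + 1 + m + 1 - m = n + 2 by omega,
        show n + 1 + m + 1 = n + 1 + 1 + m by omega] at h
      have h' : (((n + 1 + m).choose m : ℕ) : ℝ) * ((n + 1 + 1 + m : ℕ) : ℝ)
          = ((n + 1 + 1 + m).choose m : ℕ) * ((n + 2 : ℕ) : ℝ) := by exact_mod_cast h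
      push_cast at h'
      linarith
    have hmono : (((n + m).choose m : ℕ) : ℝ) ≤ ((n + 1 + m).choose m : ℕ) := by
      exact_mod_cast Nat.choose_le_choose m (by omega)
    have hn : (0 : ℝ) ≤ n := n.cast_nonneg
    have hstep : ((n : ℝ) + 2) * |ω (n + 2)| ≤ n * |ω n| + 2 * |ν| * |ω (n + 1)| := by
      calc ((n : ℝ) + 2) * |ω (n + 2)| = |n * ω n - 2 * ν * ω (n + 1)| := by
            have hn2 : |(n : ℝ) + 2| = n + 2 := abs_of_nonneg (by linarith)
            trans |((n : ℝ) + 2) * ω (n + 2)|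
            · rw [abs_mul, hn2]
            congr 1
            linarith
        _ ≤ |n * ω n| + |2 * ν * ω (n + 1)| := abs_sub _ _
        _ = n * |ω n| + 2 * |ν| * |ω (n + 1)| := by simp [abs_mul]
    have hA : (n : ℝ) * |ω n| ≤ n * ((n + 1 + m).choose m : ℕ) :=
      mul_le_mul_of_nonneg_left (ih0.trans hmono) hn
    have hB : 2 * |ν| * |ω (n + 1)| ≤ m * ((n + 1 + m).choose m : ℕ) :=
      mul_le_mul hm ih1 (abs_nonneg _) (Nat.cast_nonneg _)
    have hC : (0 : ℝ) ≤ ((n + 1 + m).choose m : ℕ) := Nat.cast_nonneg _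
    refine le_of_mul_le_mul_left ?_ (by linarith : (0 : ℝ) < n + 2)
    linarith

/-- Polynomially bounded coefficients give summable differentiated power series inside the unit
disc. -/
lemma summable_nat_mul_abs_mul_pow {a : ℕ → ℝ} {m : ℕ}
    (ha : ∀ k, |a k| ≤ ((k + m).choose m : ℝ)) {r : ℝ} (hr0 : 0 ≤ r) (hr1 : r < 1) :
    Summable fun k : ℕ => (k : ℝ) * |a k| * r ^ (k - 1) := by
  rw [← summable_nat_add_iff 1]
  have hs := (summable_choose_mul_geometric_of_norm_lt_one (R := ℝ) (m + 1)
    (r := r) (by rwa [Real.norm_of_nonneg hr0])).mul_left ((m : ℝ) + 1)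
  refine Summable.of_nonneg_of_le (fun k => by positivity) (fun k => ?_) hs
  rw [Nat.add_sub_cancel, ← mul_assoc]
  refine mul_le_mul_of_nonneg_right ?_ (by positivity)
  have h := Nat.choose_succ_right_eq (k + 1 + m) m
  rw [show k + 1 + m - m = k + 1 by omega, show k + 1 + m = k + (m + 1) by omega] at h
  have h' : (((k + (m + 1)).choose (m + 1) : ℕ) : ℝ) * ((m + 1 : ℕ) : ℝ)
      = ((k + (m + 1)).choose m : ℕ) * ((k + 1 : ℕ) : ℝ) := by exact_mod_cast h
  have hk := ha (k + 1)
  rw [show k + 1 + m = k + (m + 1) by omega] at hk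
  calc ((k + 1 : ℕ) : ℝ) * |a (k + 1)|
      ≤ ((k + 1 : ℕ) : ℝ) * ((k + (m + 1)).choose m : ℕ) := by gcongr
    _ = _ := by push_cast at h' ⊢; linarith

/-- The power series of the trapezoidal weights solves `(1 - x ^ 2) W' = -2 ν W`. -/
lemma hasDerivAt_tsum_weight (ν : ℝ) (ω : ℕ → ℝ)
    (h0 : ω 0 = 1) (h1 : ω 1 = -2 * ν)
    (hrec : ∀ k : ℕ, 1 ≤ k →
      ((k : ℝ) + 1) * ω (k + 1) = ((k : ℝ) - 1) * ω (k - 1) - 2 * ν * ω k)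
    {x : ℝ} (hx : |x| < 1) :
    Summable (fun k : ℕ => ω k * x ^ k) ∧
      HasDerivAt (fun y => ∑' k : ℕ, ω k * y ^ k)
        (-2 * ν / (1 - x ^ 2) * ∑' k : ℕ, ω k * x ^ k) x := by
  obtain ⟨m, hm⟩ := exists_nat_ge (2 * |ν|)
  have hb := abs_weight_le_choose ν ω m hm h0 h1 hrec
  obtain ⟨r, hxr, hr1⟩ := exists_between hx
  have hr0 : 0 < r := (abs_nonneg x).trans_lt hxr
  have hu := summable_nat_mul_abs_mul_pow hb hr0.le hr1
  have hball : ∀ y ∈ Metric.ball (0 : ℝ) r, |y| < r := fun y hy => by simpa using hy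
  have hder : ∀ (k : ℕ), ∀ y ∈ Metric.ball (0 : ℝ) r,
      HasDerivAt (fun z => ω k * z ^ k) (ω k * (k * y ^ (k - 1))) y :=
    fun k y _ => (hasDerivAt_pow k y).const_mul (ω k)
  have hbd : ∀ (k : ℕ), ∀ y ∈ Metric.ball (0 : ℝ) r,
      ‖ω k * (k * y ^ (k - 1))‖ ≤ (k : ℝ) * |ω k| * r ^ (k - 1) := by
    intro k y hy
    rw [Real.norm_eq_abs, abs_mul, abs_mul, abs_pow, Nat.abs_cast]
    have := pow_le_pow_left₀ (abs_nonneg y) (hball y hy).le (k - 1)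
    calc |ω k| * (k * |y| ^ (k - 1)) = (k : ℝ) * |ω k| * |y| ^ (k - 1) := by ring
      _ ≤ _ := by gcongr
  have hpre : IsPreconnected (Metric.ball (0 : ℝ) r) := (convex_ball 0 r).isPreconnected
  have hz : Summable fun k : ℕ => ω k * (0 : ℝ) ^ k :=
    summable_of_ne_finset_zero (s := {0}) fun k hk => by
      simp [zero_pow (by simpa using hk : k ≠ 0)]
  have hxb : x ∈ Metric.ball (0 : ℝ) r := by simpa using hxr
  have hW : Summable fun k : ℕ => ω k * x ^ k :=
    summable_of_summable_hasDerivAt_of_isPreconnected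
      (g := fun k y => ω k * y ^ k) (g' := fun k y => ω k * (k * y ^ (k - 1)))
      hu Metric.isOpen_ball hpre hder hbd
      (Metric.mem_ball_self hr0) hz hxb
  have hD : HasDerivAt (fun y => ∑' k : ℕ, ω k * y ^ k)
      (∑' k : ℕ, ω k * (k * x ^ (k - 1))) x :=
    hasDerivAt_tsum_of_isPreconnected
      (g := fun k y => ω k * y ^ k) (g' := fun k y => ω k * (k * y ^ (k - 1)))
      hu Metric.isOpen_ball hpre hder hbd
      (Metric.mem_ball_self hr0) hz hxb
  refine ⟨hW, ?_⟩
  suffices h : ∑' k : ℕ, ω k * (k * x ^ (k - 1))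
      = -2 * ν / (1 - x ^ 2) * ∑' k : ℕ, ω k * x ^ k from h ▸ hD
  have hd : Summable fun k : ℕ => ω k * (k * x ^ (k - 1)) :=
    Summable.of_norm_bounded hu fun k => hbd k x hxb
  have hs : HasSum (fun k : ℕ => ω (k + 1) * ((k + 1 : ℕ) * x ^ k))
      (∑' k : ℕ, ω k * (k * x ^ (k - 1))) := by
    simpa using (hasSum_nat_add_iff' 1).mpr hd.hasSum
  have he := (hasSum_nat_add_iff' 1).mpr (hs.add (hW.hasSum.mul_left (2 * ν)))
  have he' := hd.hasSum.mul_left (x ^ 2)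
  have hfun : (fun k : ℕ => ω (k + 1 + 1) * ((k + 1 + 1 : ℕ) * x ^ (k + 1))
      + 2 * ν * (ω (k + 1) * x ^ (k + 1))) = fun k : ℕ => x ^ 2 * (ω k * (k * x ^ (k - 1))) := by
    funext k
    have h := hrec (k + 1) (by omega)
    rw [Nat.add_sub_cancel] at h
    push_cast at h ⊢
    have hp : (k : ℝ) * x ^ (k + 1) = x ^ 2 * (k * x ^ (k - 1)) := by
      cases k with
      | zero => simp
      | succ n => rw [Nat.add_sub_cancel]; ring
    linear_combination x ^ (k + 1) * h + ω k * hp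
  rw [hfun] at he
  have key := he.unique he'
  simp only [Finset.sum_range_one, h0, h1] at key
  have hx2 : 1 - x ^ 2 ≠ 0 := by
    have := (sq_lt_one_iff_abs_lt_one x).mpr hx
    linarith
  rw [div_mul_eq_mul_div, eq_div_iff hx2]
  norm_num at key
  linarith

/-- TR-based convolution quadrature weights: the sequence generated by `ω₀ = 1`,
`ω₁ = -2ν`, `(k+1)ω_{k+1} = (k-1)ω_{k-1} - 2ν ω_k` for `k ≥ 1` gives the Taylor
coefficients of `ξ ↦ ((1-ξ)/(1+ξ))^ν` on `|ξ| < 1`. -/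
theorem stmt16 (ν : ℝ) (ω : ℕ → ℝ)
    (h0 : ω 0 = 1) (h1 : ω 1 = -2 * ν)
    (hrec : ∀ k : ℕ, 1 ≤ k →
      ((k : ℝ) + 1) * ω (k + 1) = ((k : ℝ) - 1) * ω (k - 1) - 2 * ν * ω k) :
    ∀ ξ : ℝ, |ξ| < 1 →
      HasSum (fun k : ℕ => ω k * ξ ^ k) (((1 - ξ) / (1 + ξ)) ^ ν) := by
  intro ξ hξ
  have hW := fun {x : ℝ} (hx : |x| < 1) => hasDerivAt_tsum_weight ν ω h0 h1 hrec hx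
  have hball : ∀ y ∈ Metric.ball (0 : ℝ) 1, |y| < 1 := fun y hy => by simpa using hy
  have hg : ∀ y ∈ Metric.ball (0 : ℝ) 1, HasDerivAt
      (fun y => (∑' k : ℕ, ω k * y ^ k) * ((1 - y) / (1 + y)) ^ (-ν)) 0 y := by
    intro y hy
    have hy' := abs_lt.mp (hball y hy)
    have hp : 0 < 1 + y := by linarith
    have hq : 0 < 1 - y := by linarith
    have hquot : HasDerivAt (fun y : ℝ => (1 - y) / (1 + y))
        ((-1 * (1 + y) - (1 - y) * 1) / (1 + y) ^ 2) y :=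
      ((hasDerivAt_id y).const_sub 1).div ((hasDerivAt_id y).const_add 1) hp.ne'
    have hpow := hquot.rpow_const (p := -ν) (Or.inl (div_pos hq hp).ne')
    refine ((hW (hball y hy)).2.mul hpow).congr_deriv ?_
    rw [Real.rpow_sub_one (div_pos hq hp).ne', show 1 - y ^ 2 = (1 - y) * (1 + y) by ring]
    field_simp
    ring
  have hconst := Metric.isOpen_ball.is_const_of_deriv_eq_zero
    (convex_ball (0 : ℝ) 1).isPreconnected
    (fun y hy => (hg y hy).differentiableAt.differentiableWithinAt)
    (fun y hy => (hg y hy).deriv) (show ξ ∈ Metric.ball (0 : ℝ) 1 by simpa using hξ)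
    (Metric.mem_ball_self one_pos)
  have hz : ∑' k : ℕ, ω k * (0 : ℝ) ^ k = 1 := by
    rw [tsum_eq_single 0 fun k hk => by simp [zero_pow hk]]
    simp [h0]
  have hξ' := abs_lt.mp hξ
  have hpos : 0 < (1 - ξ) / (1 + ξ) := div_pos (by linarith) (by linarith)
  simp only [hz, sub_zero, add_zero, div_one, Real.one_rpow, mul_one] at hconst
  rw [Real.rpow_neg hpos.le, mul_inv_eq_one₀ (Real.rpow_pos_of_pos hpos ν).ne'] at hconst
  rw [← hconst]
  exact (hW hξ).1.hasSum
end

section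
/- Define the sequence ω : ℕ → ℝ by ω₀ = 1, ω₁ = 1, and the recurrence (k+1)·ω_{k+1} = (k−1)·ω_{k−1} + ω_k for all k ≥ 1 (this is the trapezoidal-rule convolution quadrature recurrence with ν = −1/2). Then for every n ∈ ℕ, ω_{2n} = ω_{2n+1} = C_n, where C_n = (2n)! / (4^n · (n!)²) = (1·3···(2n−1))/(n!·2^n). -/
/-- Closed form of the TR convolution quadrature weights for `ν = -1/2`: the sequence
generated by `ω₀ = ω₁ = 1`, `(k+1)ω_{k+1} = (k-1)ω_{k-1} + ω_k` for `k ≥ 1` satisfies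
`ω_{2n} = ω_{2n+1} = C_n` with `C_n = (2n)!/(4^n (n!)²)`. -/
theorem stmt18 (ω : ℕ → ℝ)
    (h0 : ω 0 = 1) (h1 : ω 1 = 1)
    (hrec : ∀ k : ℕ, 1 ≤ k →
      ((k : ℝ) + 1) * ω (k + 1) = ((k : ℝ) - 1) * ω (k - 1) + ω k) :
    ∀ n : ℕ,
      ω (2 * n) = (Nat.factorial (2 * n) : ℝ) / (4 ^ n * (Nat.factorial n : ℝ) ^ 2) ∧
      ω (2 * n + 1) = (Nat.factorial (2 * n) : ℝ) / (4 ^ n * (Nat.factorial n : ℝ) ^ 2) := by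
  intro n
  induction n with
  | zero => simp [h0, h1]
  | succ n ih =>
    obtain ⟨heven, hodd⟩ := ih
    have hC : (2 * (n : ℝ) + 2) *
        ((Nat.factorial (2 * (n + 1)) : ℝ) / (4 ^ (n + 1) * (Nat.factorial (n + 1) : ℝ) ^ 2)) =
        (2 * n + 1) * ((Nat.factorial (2 * n) : ℝ) / (4 ^ n * (Nat.factorial n : ℝ) ^ 2)) := by
      rw [show 2 * (n + 1) = 2 * n + 1 + 1 by ring, Nat.factorial_succ, Nat.factorial_succ,
        Nat.factorial_succ]
      have hn : (Nat.factorial n : ℝ) ≠ 0 := by positivity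
      push_cast
      field_simp
      ring
    generalize (Nat.factorial (2 * (n + 1)) : ℝ) /
      (4 ^ (n + 1) * (Nat.factorial (n + 1) : ℝ) ^ 2) = C' at hC ⊢
    have h2 := hrec (2 * n + 1) (by omega)
    have h3 := hrec (2 * n + 2) (by omega)
    simp only [Nat.add_sub_cancel, show 2 * n + 2 - 1 = 2 * n + 1 by omega] at h2 h3
    rw [← hodd] at hC heven
    rw [heven] at h2
    push_cast at h2 h3
    have hnext : ω (2 * n + 2) = C' := by
      have hpos : (2 * (n : ℝ) + 2) ≠ 0 := by positivity
      apply mul_left_cancel₀ hpos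
      linear_combination h2 - hC
    refine ⟨hnext, ?_⟩
    have hpos : (2 * (n : ℝ) + 3) ≠ 0 := by positivity
    apply mul_left_cancel₀ hpos
    change _ * ω (2 * n + 2 + 1) = _
    linear_combination h3 + hnext - hC
end
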